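/- Let k ≥ 1 be an integer, let t ∈ ℤ_p be nonzero, and let N ∈ ℤ_p be nonzero with v_p(N) ≥ 2. Then lim_{m→∞} Den(⟨−N⟩ ⊥ H_{2k+2}^+, ⟨t⟩ ⊥ ⟨p^m⟩) = [Pden(H_{2k+4}^+, ⟨p⟩) / Pden(H_{2k+4}^+, ⟨N⟩)] · [Den(H_{2k+2}^+, ⟨N⟩ ⊥ ⟨t⟩) − p^{−2k} · Den(H_{2k+2}^+, ⟨N·p^{−2}⟩ ⊥ ⟨t⟩)] / (1 − p^{−2k}), all the local densities occurring being defined (the limits defining them exist). -/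

import Mathlib

open Filter Topology

namespace PaperStmt

/-- Reduction mod `p^d` of a quadratic form on `ℤ_p^n` (induced form on `(ℤ/p^d)^n`). -/
noncomputable def qRed (p : ℕ) [Fact p.Prime] (d : ℕ) {n : ℕ}
    (Q : QuadraticForm ℤ_[p] (Fin n → ℤ_[p])) (x : Fin n → ZMod (p ^ d)) : ZMod (p ^ d) :=
  PadicInt.toZModPow d (Q fun i => ((x i).val : ℤ_[p]))

/-- `Rep_{M,L}(ℤ/p^d)`: module homomorphisms (encoded as matrices) preserving the induced
quadratic forms. -/
noncomputable def RepSet (p : ℕ) [Fact p.Prime] {m n : ℕ}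
    (QM : QuadraticForm ℤ_[p] (Fin m → ℤ_[p])) (QL : QuadraticForm ℤ_[p] (Fin n → ℤ_[p]))
    (d : ℕ) : Set (Matrix (Fin m) (Fin n) (ZMod (p ^ d))) :=
  {T | ∀ x : Fin n → ZMod (p ^ d), qRed p d QM (T.mulVec x) = qRed p d QL x}

/-- `PRep_{M,L}(ℤ/p^d)`: those elements of `Rep` that are isomorphisms onto a direct summand
(equivalently, split injections, i.e. left invertible). -/
noncomputable def PRepSet (p : ℕ) [Fact p.Prime] {m n : ℕ}
    (QM : QuadraticForm ℤ_[p] (Fin m → ℤ_[p])) (QL : QuadraticForm ℤ_[p] (Fin n → ℤ_[p]))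
    (d : ℕ) : Set (Matrix (Fin m) (Fin n) (ZMod (p ^ d))) :=
  {T | T ∈ RepSet p QM QL d ∧ ∃ S : Matrix (Fin n) (Fin m) (ZMod (p ^ d)), S * T = 1}

/-- The local density `Den(M,L)` exists and equals `D`. -/
noncomputable def HasDen (p : ℕ) [Fact p.Prime] {m n : ℕ}
    (QM : QuadraticForm ℤ_[p] (Fin m → ℤ_[p])) (QL : QuadraticForm ℤ_[p] (Fin n → ℤ_[p]))
    (D : ℝ) : Prop :=
  Tendsto (fun d : ℕ =>
      ((RepSet p QM QL d).ncard : ℝ) / (p : ℝ) ^ ((d : ℤ) * ((m : ℤ) * n - n * (n + 1) / 2)))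
    atTop (𝓝 D)

/-- The primitive local density `Pden(M,L)` exists and equals `D`. -/
noncomputable def HasPden (p : ℕ) [Fact p.Prime] {m n : ℕ}
    (QM : QuadraticForm ℤ_[p] (Fin m → ℤ_[p])) (QL : QuadraticForm ℤ_[p] (Fin n → ℤ_[p]))
    (D : ℝ) : Prop :=
  Tendsto (fun d : ℕ =>
      ((PRepSet p QM QL d).ncard : ℝ) / (p : ℝ) ^ ((d : ℤ) * ((m : ℤ) * n - n * (n + 1) / 2)))
    atTop (𝓝 D)

/-- The rank one quadratic lattice `⟨a⟩`, i.e. `ℤ_p` with the form `x ↦ a·x²`. -/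
noncomputable def diagLat (p : ℕ) [Fact p.Prime] (a : ℤ_[p]) :
    QuadraticForm ℤ_[p] (Fin 1 → ℤ_[p]) :=
  LinearMap.BilinMap.toQuadraticMap
    ((LinearMap.mul ℤ_[p] ℤ_[p]).compl₁₂ (a • LinearMap.proj 0) (LinearMap.proj 0))

/-- Orthogonal direct sum of quadratic lattices. -/
noncomputable def orthSum (p : ℕ) [Fact p.Prime] {m₁ m₂ : ℕ}
    (Q₁ : QuadraticForm ℤ_[p] (Fin m₁ → ℤ_[p])) (Q₂ : QuadraticForm ℤ_[p] (Fin m₂ → ℤ_[p])) :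
    QuadraticForm ℤ_[p] (Fin (m₁ + m₂) → ℤ_[p]) :=
  (QuadraticMap.prod Q₁ Q₂).comp
    ((LinearEquiv.funCongrLeft ℤ_[p] ℤ_[p] finSumFinEquiv).trans
      (LinearEquiv.sumArrowLequivProdArrow (Fin m₁) (Fin m₂) ℤ_[p] ℤ_[p])).toLinearMap

/-- The self-dual lattice `H_{2K}^+ = (H_2^+)^{⊥ K}`, with form `x ↦ Σ_i x_{2i}·x_{2i+1}`. -/
noncomputable def Hplus (p : ℕ) [Fact p.Prime] (K : ℕ) :
    QuadraticForm ℤ_[p] (Fin (2 * K) → ℤ_[p]) :=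
  LinearMap.BilinMap.toQuadraticMap
    (∑ i : Fin K, (LinearMap.mul ℤ_[p] ℤ_[p]).compl₁₂
      (LinearMap.proj ⟨2 * i.1, by have := i.2; omega⟩)
      (LinearMap.proj ⟨2 * i.1 + 1, by have := i.2; omega⟩))

/-- Nondegeneracy of a quadratic lattice (the Gram matrix of the polar form has nonzero
determinant, equivalently the form is nondegenerate over `ℚ_p`). -/
def NondegQF (p : ℕ) [Fact p.Prime] {n : ℕ}
    (Q : QuadraticForm ℤ_[p] (Fin n → ℤ_[p])) : Prop :=
  (Matrix.of fun i j : Fin n =>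
    QuadraticMap.polar (⇑Q) (Pi.single i 1) (Pi.single j 1)).det ≠ 0

open QuadraticMap

section Counting

theorem card_subtype_of_fibers {A B : Type*} [Finite A] [Finite B] (f : A → B) (S : B → Prop)
    (P : A → Prop) (k : ℕ) (h : ∀ b, S b → Nat.card {a // f a = b ∧ P a} = k) :
    Nat.card {a // S (f a) ∧ P a} = Nat.card {b // S b} * k := by
  have e : {a // S (f a) ∧ P a} ≃ Σ b : {b // S b}, {a // f a = b.1 ∧ P a} :=
    { toFun := fun a => ⟨⟨f a.1, a.2.1⟩, ⟨a.1, rfl, a.2.2⟩⟩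
      invFun := fun x => ⟨x.2.1, x.2.2.1.symm ▸ x.1.2, x.2.2.2⟩
      left_inv := fun _ => rfl
      right_inv := by
        rintro ⟨⟨b, hb⟩, ⟨a, hab, ha⟩⟩
        dsimp only at hab
        subst hab
        rfl }
  have := Fintype.ofFinite {b // S b}
  rw [Nat.card_congr e, Nat.card_sigma, Finset.sum_congr rfl fun b _ => h b.1 b.2]
  simp

theorem card_preimage_of_fibers {A B : Type*} [Finite A] [Finite B] (f : A → B) (S : B → Prop)
    (k : ℕ) (h : ∀ b, S b → Nat.card {a // f a = b} = k) :
    Nat.card {a // S (f a)} = Nat.card {b // S b} * k := by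
  simpa using card_subtype_of_fibers f S (fun _ => True) k (by simpa using h)

theorem card_subtype_prod {A B : Type*} [Finite A] [Finite B] (S : A → Prop)
    (P : A → B → Prop) (k : ℕ) (h : ∀ a, S a → Nat.card {b // P a b} = k) :
    Nat.card {z : A × B // S z.1 ∧ P z.1 z.2} = Nat.card {a // S a} * k := by
  refine card_subtype_of_fibers Prod.fst S (fun z : A × B => P z.1 z.2) k fun a ha => ?_
  rw [← h a ha]
  exact Nat.card_congr
    { toFun := fun z => ⟨z.1.2, by simpa only [z.2.1] using z.2.2⟩
      invFun := fun b => ⟨(a, b.1), rfl, b.2⟩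
      left_inv := by
        rintro ⟨⟨_, b⟩, rfl, hb⟩
        rfl
      right_inv := fun _ => rfl }

theorem card_fiber_eq_card_ker {A B : Type*} [AddGroup A] [AddGroup B] (f : A →+ B) (a₀ : A) :
    Nat.card {a // f a = f a₀} = Nat.card {a // f a = 0} :=
  Nat.card_congr ((Equiv.subRight a₀).subtypeEquiv fun a => by simp [sub_eq_zero])

theorem card_fiber_mul_card {A B : Type*} [AddGroup A] [AddGroup B] [Finite A] [Finite B]
    (f : A →+ B) (hf : Function.Surjective f) (b : B) :
    Nat.card B * Nat.card {a // f a = b} = Nat.card A := by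
  have key : ∀ b, Nat.card {a // f a = b} = Nat.card {a // f a = 0} := fun b => by
    obtain ⟨a, rfl⟩ := hf b
    exact card_fiber_eq_card_ker f a
  have := card_preimage_of_fibers f (fun _ => True) _ fun b _ => key b
  rw [key b]
  simpa using this.symm

end Counting

section GramCount

variable {R X : Type*} [CommRing R] [AddCommGroup X] [Module R X]

/-- The number of pairs `(x, y)` with Gram data `Q x = t`, `Q y = s`, `polar Q x y = ν` and such
that `y` satisfies `P`. -/
noncomputable def gramCount (Q : QuadraticForm R X) (P : X → Prop) (t s ν : R) : ℕ :=
  Nat.card {z : X × X // (Q z.1 = t ∧ Q z.2 = s ∧ polar Q z.1 z.2 = ν) ∧ P z.2}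

theorem map_smul_add_smul (Q : QuadraticForm R X) (a b : R) (x y : X) :
    Q (a • x + b • y) = a ^ 2 * Q x + b ^ 2 * Q y + a * b * polar Q x y := by
  have h := QuadraticMap.map_add Q (a • x) (b • y)
  rw [h, Q.map_smul, Q.map_smul, polar_smul_left, polar_smul_right]
  simp only [smul_eq_mul]
  ring

theorem polar_self_eq (Q : QuadraticForm R X) (x : X) : polar Q x x = 2 * Q x := by
  rw [QuadraticMap.polar_self, two_nsmul, two_mul]

theorem gramCount_shear (Q : QuadraticForm R X) (P : X → Prop) (g h : Rˣ) (c t s : R)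
    (hP : ∀ x y, P ((h : R) • y + c • x) ↔ P y) :
    gramCount Q P ((g : R) ^ 2 * t) ((h : R) ^ 2 * s + c ^ 2 * t) (2 * g * c * t) =
      gramCount Q P t s 0 := by
  symm
  let e : X × X ≃ X × X :=
    { toFun := fun z => ((g : R) • z.1, (h : R) • z.2 + c • z.1)
      invFun := fun z =>
        ((↑g⁻¹ : R) • z.1, (↑h⁻¹ : R) • (z.2 - c • (↑g⁻¹ : R) • z.1))
      left_inv := fun z => by simp [smul_smul]
      right_inv := fun z => by simp [smul_smul] }
  refine Nat.card_congr (e.subtypeEquiv fun z => ?_)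
  obtain ⟨x, y⟩ := z
  have e1 : Q ((g : R) • x) = (g : R) ^ 2 * Q x := by
    rw [Q.map_smul, smul_eq_mul, _root_.sq]
  have e2 := map_smul_add_smul Q h c y x
  have e3 : polar Q ((g : R) • x) ((h : R) • y + c • x) =
      g * h * polar Q x y + 2 * g * c * Q x := by
    rw [polar_smul_left, polar_add_right, polar_smul_right, polar_smul_right, polar_self_eq]
    simp only [smul_eq_mul]
    ring
  simp only [e, Equiv.coe_fn_mk, hP, e1, e2, e3, polar_comm _ y x]
  refine and_congr_left fun _ => ?_
  constructor
  · rintro ⟨rfl, rfl, h0⟩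
    simp [h0]
  · rintro ⟨h1, h2, h3⟩
    have h1' : Q x = t := (g.isUnit.pow 2).mul_left_cancel h1
    subst h1'
    have h3' : polar Q x y = 0 := by
      have : ((g * h : Rˣ) : R) * polar Q x y = ((g * h : Rˣ) : R) * 0 := by
        push_cast
        linear_combination h3
      exact (g * h).isUnit.mul_left_cancel this
    refine ⟨rfl, (h.isUnit.pow 2).mul_left_cancel ?_, h3'⟩
    linear_combination h2 - h * c * h3'

theorem gramCount_swap (Q : QuadraticForm R X) (t s ν : R) :
    gramCount Q (fun _ => True) t s ν = gramCount Q (fun _ => True) s t ν := by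
  refine Nat.card_congr ((Equiv.prodComm X X).subtypeEquiv fun z => ?_)
  simp only [Equiv.prodComm_apply, Prod.fst_swap, Prod.snd_swap, polar_comm Q z.2 z.1]
  tauto

theorem card_gram_mem [Finite R] [Finite X] (Q : QuadraticForm R X) (P : X → Prop)
    (S : R × R × R → Prop) (k : ℕ) (h : ∀ t s ν, S (t, s, ν) → gramCount Q P t s ν = k) :
    Nat.card {z : X × X // S (Q z.1, Q z.2, polar Q z.1 z.2) ∧ P z.2} = Nat.card {b // S b} * k := by
  refine card_subtype_of_fibers (fun z : X × X => (Q z.1, Q z.2, polar Q z.1 z.2)) S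
    (fun z => P z.2) k ?_
  rintro ⟨t, s, ν⟩ hS
  rw [← h t s ν hS]
  simp only [Prod.mk.injEq]
  rfl

end GramCount

section Padic

variable {p : ℕ} [Fact p.Prime]

theorem exists_dvd_prime_pow {a : ℤ_[p]} (ha : a ≠ 0) : ∃ e : ℕ, a ∣ (p : ℤ_[p]) ^ e := by
  refine ⟨a.valuation, ?_⟩
  conv_lhs => rw [PadicInt.unitCoeff_spec ha]
  exact (Units.mul_left_dvd).2 dvd_rfl

theorem isUnit_one_add_prime_mul (z : ℤ_[p]) : IsUnit (1 + p * z) := by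
  by_contra h
  have h1 : 1 + p * z ∈ IsLocalRing.maximalIdeal ℤ_[p] := h
  rw [PadicInt.maximalIdeal_eq_span_p, Ideal.mem_span_singleton] at h1
  exact PadicInt.prime_p.not_isUnit
    (isUnit_of_dvd_one ((dvd_add_left (dvd_mul_right _ z)).1 h1))

theorem exists_unit_sq_eq (z : ℤ_[p]) : ∃ h : ℤ_[p]ˣ, (h : ℤ_[p]) ^ 2 = 1 + 4 * p * z := by
  have h2 : (2 : ℤ_[p]) ≠ 0 := two_ne_zero
  have hlt : ‖(p : ℤ_[p]) * z‖ < 1 :=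
    (PadicInt.norm_lt_one_iff_dvd _).2 (dvd_mul_right _ _)
  obtain ⟨w, hw, -⟩ := hensels_lemma (p := p) (R := ℤ_[p])
    (F := Polynomial.X ^ 2 - Polynomial.C (1 + 4 * p * z)) (a := 1) (by
      have e1 : (1 : ℤ_[p]) - (1 + 4 * p * z) = -(2 * 2 * (p * z)) := by ring
      simp only [Polynomial.aeval_def, Polynomial.eval₂_sub, Polynomial.eval₂_pow,
        Polynomial.eval₂_X, Polynomial.eval₂_C, Polynomial.derivative_sub,
        Polynomial.derivative_X_pow, Polynomial.derivative_C, Algebra.algebraMap_self,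
        RingHom.id_apply, one_pow, e1, norm_neg, norm_mul]
      have : 0 < ‖(2 : ℤ_[p])‖ := norm_pos_iff.2 h2
      rw [← norm_mul (p : ℤ_[p]) z]
      simp only [mul_one, map_ofNat, Nat.cast_ofNat, Nat.add_one_sub_one, pow_one, Polynomial.eval₂_mul,
        Polynomial.eval₂_X, Polynomial.eval₂_ofNat, Polynomial.eval₂_zero, sub_zero]
      nlinarith [mul_pos this this])
  have hw' : w ^ 2 = 1 + 4 * p * z := by
    simpa [Polynomial.aeval_def, sub_eq_zero] using hw
  have hu : IsUnit (w ^ 2) := by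
    rw [hw', show 1 + 4 * (p : ℤ_[p]) * z = 1 + p * (4 * z) by ring]
    exact isUnit_one_add_prime_mul _
  obtain ⟨u, rfl⟩ := (isUnit_pow_iff two_ne_zero).1 hu
  exact ⟨u, hw'⟩

theorem exists_unit_sq_mul_eq {a b : ℤ_[p]} (h : 4 * p * a ∣ b - a) :
    ∃ u : ℤ_[p]ˣ, (u : ℤ_[p]) ^ 2 * a = b := by
  obtain ⟨z, hz⟩ := h
  obtain ⟨u, hu⟩ := exists_unit_sq_eq z
  exact ⟨u, by rw [hu]; linear_combination -hz⟩

theorem exists_shear {t s t' s' ν : ℤ_[p]} (ht : 8 * p * s * t ∣ t' - t)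
    (hs : 8 * p * s * t ∣ s' - s) (hν : 8 * p * s * t ∣ ν) :
    ∃ (g h : ℤ_[p]ˣ) (c : ℤ_[p]), (g : ℤ_[p]) ^ 2 * t = t' ∧
      (h : ℤ_[p]) ^ 2 * s + (p * c) ^ 2 * t = s' ∧ 2 * (g : ℤ_[p]) * (p * c) * t = ν := by
  obtain ⟨g, hg⟩ := exists_unit_sq_mul_eq
    (show 4 * p * t ∣ t' - t from dvd_trans ⟨2 * s, by ring⟩ ht)
  obtain ⟨z, rfl⟩ := hν
  obtain ⟨w, hw⟩ := hs
  set c : ℤ_[p] := 4 * s * z * (↑g⁻¹ : ℤ_[p]) with hc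
  obtain ⟨h, hh⟩ := exists_unit_sq_mul_eq (a := s) (b := s' - (p * c) ^ 2 * t)
    ⟨2 * t * w - p * 4 * s * z ^ 2 * (↑g⁻¹ : ℤ_[p]) ^ 2 * t, by
      rw [hc]; linear_combination hw⟩
  refine ⟨g, h, c, hg, by rw [hh]; ring, ?_⟩
  have : (g : ℤ_[p]) * (↑g⁻¹ : ℤ_[p]) = 1 := g.mul_inv
  rw [hc]
  linear_combination 8 * p * s * z * t * this

/-- The Gram count is locally constant near a nondegenerate diagonal Gram matrix, uniformly in the
modulus and in the quadratic space. -/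
theorem exists_gramCount_locally_constant {t s : ℤ_[p]} (ht : t ≠ 0) (hs : s ≠ 0) :
    ∃ d₀ : ℕ, ∀ (D n : ℕ) (Q : QuadraticForm (ZMod (p ^ D)) (Fin n → ZMod (p ^ D)))
      (P : (Fin n → ZMod (p ^ D)) → Prop),
      (∀ (h : (ZMod (p ^ D))ˣ) (c : ZMod (p ^ D)) (x y), P ((h : ZMod (p ^ D)) • y +
        (p * c) • x) ↔ P y) →
      ∀ t' s' ν : ZMod (p ^ D), (p : ZMod (p ^ D)) ^ d₀ ∣ t' - PadicInt.toZModPow D t →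
        (p : ZMod (p ^ D)) ^ d₀ ∣ s' - PadicInt.toZModPow D s → (p : ZMod (p ^ D)) ^ d₀ ∣ ν →
        gramCount Q P t' s' ν =
          gramCount Q P (PadicInt.toZModPow D t) (PadicInt.toZModPow D s) 0 := by
  have hp : (p : ℤ_[p]) ≠ 0 := PadicInt.prime_p.ne_zero
  have h8 : (8 : ℤ_[p]) ≠ 0 := by norm_num
  obtain ⟨d₀, hd⟩ := exists_dvd_prime_pow (mul_ne_zero (mul_ne_zero (mul_ne_zero h8 hp) hs) ht)
  refine ⟨d₀, fun D n Q P hP t' s' ν ht' hs' hν => ?_⟩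
  obtain ⟨i, hi⟩ := ht'
  obtain ⟨j, hj⟩ := hs'
  obtain ⟨l, rfl⟩ := hν
  obtain ⟨i, rfl⟩ := ZMod.ringHom_surjective (PadicInt.toZModPow (p := p) D) i
  obtain ⟨j, rfl⟩ := ZMod.ringHom_surjective (PadicInt.toZModPow (p := p) D) j
  obtain ⟨l, rfl⟩ := ZMod.ringHom_surjective (PadicInt.toZModPow (p := p) D) l
  obtain ⟨g, h, c, e1, e2, e3⟩ := exists_shear (p := p) (t := t) (s := s)
    (t' := t + p ^ d₀ * i) (s' := s + p ^ d₀ * j) (ν := p ^ d₀ * l)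
    (by simpa using hd.mul_right i) (by simpa using hd.mul_right j) (hd.mul_right l)
  have := gramCount_shear Q P (Units.map (PadicInt.toZModPow (p := p) D).toMonoidHom g)
    (Units.map (PadicInt.toZModPow (p := p) D).toMonoidHom h) (p * PadicInt.toZModPow (p := p) D c)
    (PadicInt.toZModPow D t) (PadicInt.toZModPow D s) (fun x y => hP _ _ x y)
  rw [← this]
  have e1' := congrArg (PadicInt.toZModPow (p := p) D) e1
  have e2' := congrArg (PadicInt.toZModPow (p := p) D) e2
  have e3' := congrArg (PadicInt.toZModPow (p := p) D) e3
  simp only [map_add, map_mul, map_pow, map_natCast, map_ofNat] at e1' e2' e3'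
  congr 1
  · simp only [Units.coe_map]
    exact (sub_eq_iff_eq_add'.1 hi).trans e1'.symm
  · simp only [Units.coe_map]
    exact (sub_eq_iff_eq_add'.1 hj).trans e2'.symm
  · simp only [Units.coe_map]
    exact e3'.symm

theorem isUnit_or_dvd (D : ℕ) (z : ZMod (p ^ D)) : IsUnit z ∨ (p : ZMod (p ^ D)) ∣ z := by
  obtain ⟨w, rfl⟩ := ZMod.ringHom_surjective (PadicInt.toZModPow (p := p) D) z
  by_cases h : IsUnit w
  · exact .inl (h.map _)
  · have h1 : w ∈ IsLocalRing.maximalIdeal ℤ_[p] := h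
    rw [PadicInt.maximalIdeal_eq_span_p, Ideal.mem_span_singleton] at h1
    right
    simpa using map_dvd (PadicInt.toZModPow (p := p) D) h1

theorem not_isUnit_prime {D : ℕ} (hD : D ≠ 0) : ¬ IsUnit (p : ZMod (p ^ D)) := by
  rw [ZMod.isUnit_prime_iff_not_dvd Fact.out]
  exact fun h => h (dvd_pow_self p hD)

theorem isUnit_iff_not_dvd {D : ℕ} (hD : D ≠ 0) (z : ZMod (p ^ D)) :
    IsUnit z ↔ ¬ (p : ZMod (p ^ D)) ∣ z :=
  ⟨fun h h' => not_isUnit_prime hD (isUnit_of_dvd_unit h' h), (isUnit_or_dvd D z).resolve_right⟩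

theorem pow_mul_eq_zero_iff {D i : ℕ} (hi : i ≤ D) (z : ZMod (p ^ D)) :
    (p : ZMod (p ^ D)) ^ i * z = 0 ↔ ZMod.castHom (pow_dvd_pow p (Nat.sub_le D i))
      (ZMod (p ^ (D - i))) z = 0 := by
  obtain ⟨n, rfl⟩ := ZMod.natCast_zmod_surjective z
  have hp : 0 < p ^ i := pow_pos (Fact.out : p.Prime).pos i
  rw [map_natCast, ZMod.natCast_eq_zero_iff, ← Nat.cast_pow, ← Nat.cast_mul,
    ZMod.natCast_eq_zero_iff]
  conv_lhs => rw [← Nat.add_sub_cancel' hi, pow_add]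
  exact Nat.mul_dvd_mul_iff_left hp

theorem card_castHom_fiber {d D : ℕ} (h : d ≤ D) (b : ZMod (p ^ d)) :
    Nat.card {z : ZMod (p ^ D) // ZMod.castHom (pow_dvd_pow p h) (ZMod (p ^ d)) z = b} =
      p ^ (D - d) := by
  have := card_fiber_mul_card (ZMod.castHom (pow_dvd_pow p h) (ZMod (p ^ d))).toAddMonoidHom
    (ZMod.ringHom_surjective _) b
  rw [Nat.card_zmod, Nat.card_zmod] at this
  have hp : 0 < p ^ d := pow_pos (Fact.out : p.Prime).pos d
  refine Nat.eq_of_mul_eq_mul_left hp (this.trans ?_)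
  rw [← pow_add, Nat.add_sub_cancel' h]

theorem card_pow_mul_eq_zero {D i : ℕ} (hi : i ≤ D) :
    Nat.card {z : ZMod (p ^ D) // (p : ZMod (p ^ D)) ^ i * z = 0} = p ^ i := by
  simp only [pow_mul_eq_zero_iff hi]
  rw [card_castHom_fiber (Nat.sub_le D i), Nat.sub_sub_self hi]

theorem castHom_eq_zero_iff {d D : ℕ} (h : d ≤ D) (z : ZMod (p ^ D)) :
    ZMod.castHom (pow_dvd_pow p h) (ZMod (p ^ d)) z = 0 ↔ (p : ZMod (p ^ D)) ^ d ∣ z := by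
  constructor
  · obtain ⟨n, rfl⟩ := ZMod.natCast_zmod_surjective z
    rw [map_natCast, ZMod.natCast_eq_zero_iff]
    intro hn
    simpa using Nat.cast_dvd_cast (α := ZMod (p ^ D)) hn
  · rintro ⟨w, rfl⟩
    rw [map_mul, map_pow, map_natCast, ← Nat.cast_pow, ZMod.natCast_self, zero_mul]

theorem pow_dvd_of_pow_mul_eq_zero {D i : ℕ} (hi : i ≤ D) {z : ZMod (p ^ D)}
    (h : (p : ZMod (p ^ D)) ^ i * z = 0) : (p : ZMod (p ^ D)) ^ (D - i) ∣ z :=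
  (castHom_eq_zero_iff (Nat.sub_le D i) z).1 ((pow_mul_eq_zero_iff hi z).1 h)

end Padic

section Reduction

variable {p : ℕ} [Fact p.Prime] {n : ℕ}

theorem qRed_toZModPow (d : ℕ) (Q : QuadraticForm ℤ_[p] (Fin n → ℤ_[p])) (z : Fin n → ℤ_[p]) :
    qRed p d Q (fun i => PadicInt.toZModPow d (z i)) = PadicInt.toZModPow d (Q z) := by
  set l : Fin n → ℤ_[p] := fun i => ((PadicInt.toZModPow d (z i)).val : ℤ_[p]) with hl
  have h : ∀ i, ∃ w, z i - l i = (p : ℤ_[p]) ^ d * w := fun i => by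
    have : z i - l i ∈ RingHom.ker (PadicInt.toZModPow (p := p) d) := by
      rw [RingHom.mem_ker, map_sub, hl]
      simp
    rw [PadicInt.ker_toZModPow, Ideal.mem_span_singleton] at this
    exact this
  choose w hw using h
  have hz : z = (1 : ℤ_[p]) • l + (p : ℤ_[p]) ^ d • w := by
    ext i
    simp [← hw]
  have hp : PadicInt.toZModPow d ((p : ℤ_[p]) ^ d) = 0 := by
    rw [map_pow, map_natCast, ← Nat.cast_pow, ZMod.natCast_self]
  change PadicInt.toZModPow d (Q l) = _
  rw [hz, map_smul_add_smul]
  simp only [map_add, map_mul, hp, one_pow, map_pow] at hp ⊢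
  simp

theorem exists_toZModPow_eq (d : ℕ) (x : Fin n → ZMod (p ^ d)) :
    ∃ z : Fin n → ℤ_[p], x = fun i => PadicInt.toZModPow d (z i) := by
  choose z hz using fun i => ZMod.ringHom_surjective (PadicInt.toZModPow (p := p) d) (x i)
  exact ⟨z, funext fun i => (hz i).symm⟩

theorem polar_qRed_toZModPow (d : ℕ) (Q : QuadraticForm ℤ_[p] (Fin n → ℤ_[p]))
    (z w : Fin n → ℤ_[p]) :
    polar (qRed p d Q) (fun i => PadicInt.toZModPow d (z i)) (fun i => PadicInt.toZModPow d (w i)) =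
      PadicInt.toZModPow d (polar Q z w) := by
  have : (fun i => PadicInt.toZModPow d (z i)) + (fun i => PadicInt.toZModPow d (w i)) =
      fun i => PadicInt.toZModPow d ((z + w) i) := by
    ext i
    simp
  simp only [polar, this, qRed_toZModPow, map_sub]

/-- The reduction `qRed` as a quadratic form over `ℤ/p^d`. -/
noncomputable def qForm (d : ℕ) (Q : QuadraticForm ℤ_[p] (Fin n → ℤ_[p])) :
    QuadraticForm (ZMod (p ^ d)) (Fin n → ZMod (p ^ d)) :=
  QuadraticMap.ofPolar (qRed p d Q)
    (fun a x => by
      obtain ⟨z, rfl⟩ := exists_toZModPow_eq d x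
      obtain ⟨a, rfl⟩ := ZMod.ringHom_surjective (PadicInt.toZModPow (p := p) d) a
      have : PadicInt.toZModPow d a • (fun i => PadicInt.toZModPow d (z i)) =
          fun i => PadicInt.toZModPow d ((a • z) i) := by
        ext i
        simp
      rw [this, qRed_toZModPow, qRed_toZModPow, Q.map_smul]
      simp)
    (fun x x' y => by
      obtain ⟨z, rfl⟩ := exists_toZModPow_eq d x
      obtain ⟨z', rfl⟩ := exists_toZModPow_eq d x'
      obtain ⟨w, rfl⟩ := exists_toZModPow_eq d y
      have : (fun i => PadicInt.toZModPow d (z i)) + (fun i => PadicInt.toZModPow d (z' i)) =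
          fun i => PadicInt.toZModPow d ((z + z') i) := by
        ext i
        simp
      simp only [this, polar_qRed_toZModPow, polar_add_left, map_add])
    (fun a x y => by
      obtain ⟨z, rfl⟩ := exists_toZModPow_eq d x
      obtain ⟨w, rfl⟩ := exists_toZModPow_eq d y
      obtain ⟨a, rfl⟩ := ZMod.ringHom_surjective (PadicInt.toZModPow (p := p) d) a
      have : PadicInt.toZModPow d a • (fun i => PadicInt.toZModPow d (z i)) =
          fun i => PadicInt.toZModPow d ((a • z) i) := by
        ext i
        simp
      rw [this, polar_qRed_toZModPow, polar_qRed_toZModPow, polar_smul_left]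
      simp)

theorem qForm_apply (d : ℕ) (Q : QuadraticForm ℤ_[p] (Fin n → ℤ_[p]))
    (x : Fin n → ZMod (p ^ d)) : qForm d Q x = qRed p d Q x := rfl

theorem castHom_toZModPow {d D : ℕ} (h : d ≤ D) (z : ℤ_[p]) :
    ZMod.castHom (pow_dvd_pow p h) (ZMod (p ^ d)) (PadicInt.toZModPow D z) =
      PadicInt.toZModPow d z := by
  rw [← PadicInt.zmod_cast_comp_toZModPow d D h]
  rfl

/-- Coordinatewise reduction `(ℤ/p^D)^n → (ℤ/p^d)^n`. -/
def redVec {d D : ℕ} (h : d ≤ D) (n : ℕ) : (Fin n → ZMod (p ^ D)) →+ (Fin n → ZMod (p ^ d)) where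
  toFun x i := ZMod.castHom (pow_dvd_pow p h) (ZMod (p ^ d)) (x i)
  map_zero' := by ext; simp
  map_add' x y := by ext i; exact map_add _ _ _

theorem redVec_surjective {p n d D : ℕ} (h : d ≤ D) :
    Function.Surjective (redVec (p := p) h n) := fun y => by
  choose x hx using fun i =>
    ZMod.ringHom_surjective (ZMod.castHom (pow_dvd_pow p h) (ZMod (p ^ d))) (y i)
  exact ⟨x, funext hx⟩

theorem redVec_toZModPow {d D : ℕ} (h : d ≤ D) (z : Fin n → ℤ_[p]) :
    redVec h n (fun i => PadicInt.toZModPow D (z i)) = fun i => PadicInt.toZModPow d (z i) :=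
  funext fun i => castHom_toZModPow h (z i)

theorem qForm_redVec {d D : ℕ} (h : d ≤ D) (Q : QuadraticForm ℤ_[p] (Fin n → ℤ_[p]))
    (x : Fin n → ZMod (p ^ D)) :
    qForm d Q (redVec h n x) = ZMod.castHom (pow_dvd_pow p h) (ZMod (p ^ d)) (qForm D Q x) := by
  obtain ⟨z, rfl⟩ := exists_toZModPow_eq D x
  rw [redVec_toZModPow, qForm_apply, qForm_apply, qRed_toZModPow, qRed_toZModPow,
    castHom_toZModPow h]

theorem polar_qForm_redVec {d D : ℕ} (h : d ≤ D) (Q : QuadraticForm ℤ_[p] (Fin n → ℤ_[p]))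
    (x y : Fin n → ZMod (p ^ D)) :
    polar (qForm d Q) (redVec h n x) (redVec h n y) =
      ZMod.castHom (pow_dvd_pow p h) (ZMod (p ^ d)) (polar (qForm D Q) x y) := by
  simp only [polar, ← map_add, qForm_redVec, map_sub]

theorem card_redVec_fiber {d D : ℕ} (h : d ≤ D) (y : Fin n → ZMod (p ^ d)) :
    Nat.card {x // redVec (p := p) h n x = y} = p ^ ((D - d) * n) := by
  have := card_fiber_mul_card (redVec (p := p) h n) (redVec_surjective h) y
  simp only [Nat.card_fun, Nat.card_zmod, Fintype.card_fin, Nat.card_eq_fintype_card (α := Fin n)]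
    at this
  have hp : 0 < (p ^ d) ^ n := pow_pos (pow_pos (Fact.out : p.Prime).pos d) n
  refine Nat.eq_of_mul_eq_mul_left hp (this.trans ?_)
  rw [← pow_mul, ← pow_mul, ← pow_add, ← add_mul, Nat.add_sub_cancel' h]

/-- The Gram count of `⟨t⟩ ⊥ ⟨s⟩` in the reduction of `Q` modulo `p ^ d`. -/
noncomputable def repCount (d : ℕ) (Q : QuadraticForm ℤ_[p] (Fin n → ℤ_[p])) (t s : ℤ_[p]) : ℕ :=
  gramCount (qForm d Q) (fun _ => True) (PadicInt.toZModPow d t) (PadicInt.toZModPow d s) 0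

theorem diagLat_apply (a : ℤ_[p]) (x : Fin 1 → ℤ_[p]) : diagLat p a x = a * x 0 ^ 2 := by
  simp [diagLat, LinearMap.BilinMap.toQuadraticMap_apply]
  ring

theorem orthSum_apply {m₁ m₂ : ℕ} (Q₁ : QuadraticForm ℤ_[p] (Fin m₁ → ℤ_[p]))
    (Q₂ : QuadraticForm ℤ_[p] (Fin m₂ → ℤ_[p])) (x : Fin (m₁ + m₂) → ℤ_[p]) :
    orthSum p Q₁ Q₂ x =
      Q₁ (fun i => x (Fin.castAdd m₂ i)) + Q₂ (fun i => x (Fin.natAdd m₁ i)) := by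
  simp only [orthSum, QuadraticMap.comp_apply, QuadraticMap.prod_apply]
  rfl

theorem qRed_orthSum_diagLat (d : ℕ) (t s : ℤ_[p]) (x : Fin (1 + 1) → ZMod (p ^ d)) :
    qRed p d (orthSum p (diagLat p t) (diagLat p s)) x =
      PadicInt.toZModPow d t * x 0 ^ 2 + PadicInt.toZModPow d s * x 1 ^ 2 := by
  obtain ⟨z, rfl⟩ := exists_toZModPow_eq d x
  rw [qRed_toZModPow, orthSum_apply, diagLat_apply, diagLat_apply]
  simp

theorem mem_RepSet_orthSum_diagLat (d : ℕ) (Q : QuadraticForm ℤ_[p] (Fin n → ℤ_[p])) (t s : ℤ_[p])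
    (T : Matrix (Fin n) (Fin (1 + 1)) (ZMod (p ^ d))) :
    T ∈ RepSet p Q (orthSum p (diagLat p t) (diagLat p s)) d ↔
      qForm d Q (T.col 0) = PadicInt.toZModPow d t ∧
      qForm d Q (T.col 1) = PadicInt.toZModPow d s ∧
      polar (qForm d Q) (T.col 0) (T.col 1) = 0 := by
  have hT : ∀ x : Fin (1 + 1) → ZMod (p ^ d), T.mulVec x = x 0 • T.col 0 + x 1 • T.col 1 :=
    fun x => by
      ext i
      simp [Matrix.mulVec, dotProduct, Fin.sum_univ_two, mul_comm]
  have key : T ∈ RepSet p Q (orthSum p (diagLat p t) (diagLat p s)) d ↔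
      ∀ a b : ZMod (p ^ d), a ^ 2 * qForm d Q (T.col 0) + b ^ 2 * qForm d Q (T.col 1) +
        a * b * polar (qForm d Q) (T.col 0) (T.col 1) =
        PadicInt.toZModPow d t * a ^ 2 + PadicInt.toZModPow d s * b ^ 2 := by
    simp only [← map_smul_add_smul]
    refine ⟨fun h a b => ?_, fun h x => ?_⟩
    · have := h ![a, b]
      rw [hT, qRed_orthSum_diagLat, ← qForm_apply] at this
      simpa using this
    · rw [hT, qRed_orthSum_diagLat, ← qForm_apply]
      exact h (x 0) (x 1)
  rw [key]
  constructor
  · intro h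
    have h1 := h 1 0
    have h2 := h 0 1
    have h3 := h 1 1
    simp only [one_pow, one_mul, ne_eq, OfNat.ofNat_ne_zero, not_false_eq_true, zero_pow, zero_mul,
      mul_zero, add_zero, mul_one, zero_add] at h1 h2 h3
    refine ⟨h1, h2, ?_⟩
    rw [h1, h2] at h3
    simpa using h3
  · rintro ⟨h1, h2, h3⟩ a b
    rw [h1, h2, h3]
    ring

theorem ncard_RepSet_orthSum_diagLat (d : ℕ) (Q : QuadraticForm ℤ_[p] (Fin n → ℤ_[p]))
    (t s : ℤ_[p]) :
    (RepSet p Q (orthSum p (diagLat p t) (diagLat p s)) d).ncard = repCount d Q t s := by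
  rw [← Nat.card_coe_set_eq]
  let e : Matrix (Fin n) (Fin (1 + 1)) (ZMod (p ^ d)) ≃
      (Fin n → ZMod (p ^ d)) × (Fin n → ZMod (p ^ d)) :=
    { toFun := fun T => (T.col 0, T.col 1)
      invFun := fun z => Matrix.of fun i => ![z.1 i, z.2 i]
      left_inv := fun T => by
        ext i j
        fin_cases j <;> rfl
      right_inv := fun z => rfl }
  refine Nat.card_congr (e.subtypeEquiv fun T => ?_)
  rw [mem_RepSet_orthSum_diagLat, and_true]
  rfl

theorem repCount_comm (d : ℕ) (Q : QuadraticForm ℤ_[p] (Fin n → ℤ_[p])) (t s : ℤ_[p]) :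
    repCount d Q t s = repCount d Q s t :=
  gramCount_swap _ _ _ _

theorem exists_repCount_succ {t s : ℤ_[p]} (ht : t ≠ 0) (hs : s ≠ 0) :
    ∃ d₀ : ℕ, ∀ (n : ℕ) (Q : QuadraticForm ℤ_[p] (Fin n → ℤ_[p])), ∀ d ≥ d₀,
      p ^ 3 * repCount (d + 1) Q t s = p ^ (2 * n) * repCount d Q t s := by
  obtain ⟨d₀, hd₀⟩ := exists_gramCount_locally_constant ht hs
  refine ⟨d₀, fun n Q d hd => ?_⟩
  have hle : d ≤ d + 1 := d.le_succ
  let c := ZMod.castHom (pow_dvd_pow p hle) (ZMod (p ^ d))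
  let S : ZMod (p ^ (d + 1)) × ZMod (p ^ (d + 1)) × ZMod (p ^ (d + 1)) → Prop := fun b =>
    c b.1 = PadicInt.toZModPow d t ∧ c b.2.1 = PadicInt.toZModPow d s ∧ c b.2.2 = 0
  have hc : ∀ b : ZMod (p ^ (d + 1)), ∀ a : ℤ_[p], c b = PadicInt.toZModPow d a →
      (p : ZMod (p ^ (d + 1))) ^ d₀ ∣ b - PadicInt.toZModPow (d + 1) a := fun b a h => by
    refine (pow_dvd_pow _ hd).trans ((castHom_eq_zero_iff hle _).1 ?_)
    rw [map_sub, castHom_toZModPow hle, sub_eq_zero]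
    exact h
  have h1 := card_gram_mem (qForm (d + 1) Q) (fun _ => True) S (repCount (d + 1) Q t s)
    (fun t' s' ν ⟨h1, h2, h3⟩ => hd₀ _ _ _ _ (fun _ _ _ _ => Iff.rfl) _ _ _ (hc _ _ h1)
      (hc _ _ h2) (by simpa using hc ν 0 (by simpa using h3)))
  have h2 : Nat.card {b // S b} = p ^ 3 := by
    have e : {b // S b} ≃ {b // c b = PadicInt.toZModPow d t} ×
        {b // c b = PadicInt.toZModPow d s} × {b // c b = 0} :=
      { toFun := fun b => (⟨_, b.2.1⟩, ⟨_, b.2.2.1⟩, ⟨_, b.2.2.2⟩)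
        invFun := fun b => ⟨(b.1, b.2.1, b.2.2), b.1.2, b.2.1.2, b.2.2.2⟩
        left_inv := fun _ => rfl
        right_inv := fun _ => rfl }
    rw [Nat.card_congr e, Nat.card_prod, Nat.card_prod, card_castHom_fiber hle,
      card_castHom_fiber hle, card_castHom_fiber hle, Nat.add_sub_cancel_left]
    ring
  have h3 := card_preimage_of_fibers
    (fun z : (Fin n → ZMod (p ^ (d + 1))) × (Fin n → ZMod (p ^ (d + 1))) =>
      (redVec (p := p) hle n z.1, redVec (p := p) hle n z.2))
    (fun z => (qForm d Q z.1 = PadicInt.toZModPow d t ∧ qForm d Q z.2 = PadicInt.toZModPow d s ∧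
      polar (qForm d Q) z.1 z.2 = 0) ∧ True) (p ^ (2 * n)) (by
      rintro ⟨x, y⟩ -
      have e : {z : (Fin n → ZMod (p ^ (d + 1))) × (Fin n → ZMod (p ^ (d + 1))) //
          (redVec (p := p) hle n z.1, redVec (p := p) hle n z.2) = (x, y)} ≃
          {z // redVec (p := p) hle n z = x} × {z // redVec (p := p) hle n z = y} :=
        { toFun := fun z => (⟨_, (Prod.mk.inj z.2).1⟩, ⟨_, (Prod.mk.inj z.2).2⟩)
          invFun := fun z => ⟨(z.1, z.2), Prod.ext z.1.2 z.2.2⟩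
          left_inv := fun _ => rfl
          right_inv := fun _ => rfl }
      rw [Nat.card_congr e, Nat.card_prod, card_redVec_fiber, card_redVec_fiber,
        Nat.add_sub_cancel_left]
      ring)
  simp only [qForm_redVec, polar_qForm_redVec] at h3
  rw [h2] at h1
  exact h1.symm.trans (h3.trans (mul_comm _ _))

/-- The normalized number of representations modulo `p ^ d`. -/
noncomputable def repDensity (d : ℕ) (Q : QuadraticForm ℤ_[p] (Fin n → ℤ_[p])) (t s : ℤ_[p]) : ℝ :=
  repCount d Q t s / (p : ℝ) ^ ((d : ℤ) * (2 * n - 3))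

theorem eventually_repDensity_eq {t s : ℤ_[p]} (ht : t ≠ 0) (hs : s ≠ 0)
    (Q : QuadraticForm ℤ_[p] (Fin n → ℤ_[p])) :
    ∃ δ : ℝ, ∀ᶠ d in atTop, repDensity d Q t s = δ := by
  obtain ⟨d₀, hd₀⟩ := exists_repCount_succ (p := p) ht hs
  refine ⟨repDensity d₀ Q t s, eventually_atTop.2 ⟨d₀, fun d hd => ?_⟩⟩
  induction d, hd using Nat.le_induction with
  | base => rfl
  | succ d hd ih =>
    rw [← ih]
    have hp : (p : ℝ) ≠ 0 := Nat.cast_ne_zero.2 (Fact.out : p.Prime).ne_zero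
    have h : (p : ℝ) ^ 3 * repCount (d + 1) Q t s = (p : ℝ) ^ (2 * n) * repCount d Q t s := by
      exact_mod_cast hd₀ n Q d hd
    have e : (p : ℝ) ^ (((d + 1 : ℕ) : ℤ) * (2 * n - 3)) * (p : ℝ) ^ 3 =
        (p : ℝ) ^ ((d : ℤ) * (2 * n - 3)) * (p : ℝ) ^ (2 * n) := by
      rw [← zpow_natCast, ← zpow_natCast, ← zpow_add₀ hp, ← zpow_add₀ hp]
      congr 1
      push_cast
      ring
    unfold repDensity
    rw [div_eq_div_iff (zpow_ne_zero _ hp) (zpow_ne_zero _ hp)]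
    have h3 : (p : ℝ) ^ 3 ≠ 0 := pow_ne_zero _ hp
    refine mul_left_cancel₀ h3 ?_
    linear_combination (p : ℝ) ^ ((d : ℤ) * (2 * n - 3)) * h - (repCount d Q t s : ℝ) * e

theorem hasDen_of_eventually_eq {t s : ℤ_[p]} {Q : QuadraticForm ℤ_[p] (Fin n → ℤ_[p])} {δ : ℝ}
    (h : ∀ᶠ d in atTop, repDensity d Q t s = δ) :
    HasDen p Q (orthSum p (diagLat p t) (diagLat p s)) δ := by
  refine tendsto_const_nhds.congr' (h.mono fun d hd => ?_)
  dsimp only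
  rw [← hd, ncard_RepSet_orthSum_diagLat, repDensity]
  congr 3
  push_cast
  norm_num
  ring

theorem repDensity_comm (d : ℕ) (Q : QuadraticForm ℤ_[p] (Fin n → ℤ_[p])) (t s : ℤ_[p]) :
    repDensity d Q t s = repDensity d Q s t := by
  rw [repDensity, repDensity, repCount_comm]

end Reduction

section Primitive

/-- A vector with a unit coordinate. -/
def IsPrimVec {R : Type*} [CommRing R] {n : ℕ} (x : Fin n → R) : Prop := ∃ j, IsUnit (x j)

variable {p : ℕ} [Fact p.Prime] {n D : ℕ}

theorem isUnit_add_prime_mul_iff (hD : D ≠ 0) (z w : ZMod (p ^ D)) :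
    IsUnit (z + p * w) ↔ IsUnit z := by
  rw [isUnit_iff_not_dvd hD, isUnit_iff_not_dvd hD, dvd_add_left (dvd_mul_right _ w)]

theorem isPrimVec_unit_smul_add_iff (hD : D ≠ 0) (h : (ZMod (p ^ D))ˣ) (c : ZMod (p ^ D))
    (x y : Fin n → ZMod (p ^ D)) :
    IsPrimVec ((h : ZMod (p ^ D)) • y + (p * c) • x) ↔ IsPrimVec y := by
  refine exists_congr fun j => ?_
  simp only [Pi.add_apply, Pi.smul_apply, smul_eq_mul, mul_assoc]
  rw [isUnit_add_prime_mul_iff hD, Units.isUnit_units_mul]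

theorem not_isPrimVec_iff (hD : D ≠ 0) (y : Fin n → ZMod (p ^ D)) :
    ¬ IsPrimVec y ↔ ∃ y', y = (p : ZMod (p ^ D)) • y' := by
  simp only [IsPrimVec, not_exists, isUnit_iff_not_dvd hD, not_not]
  constructor
  · intro h
    choose y' hy' using h
    exact ⟨y', funext hy'⟩
  · rintro ⟨y', rfl⟩ j
    exact dvd_mul_right _ _

theorem exists_repCount_scale {t s : ℤ_[p]} (ht : t ≠ 0) (hs : s ≠ 0) :
    ∃ d₀ : ℕ, ∀ (n : ℕ) (Q : QuadraticForm ℤ_[p] (Fin n → ℤ_[p])), ∀ D ≥ d₀,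
      p ^ 3 * repCount D Q t s = p ^ n * gramCount (qForm D Q) (fun y => ¬ IsPrimVec y)
        (PadicInt.toZModPow D t) (PadicInt.toZModPow D ((p : ℤ_[p]) ^ 2 * s)) 0 := by
  obtain ⟨d₀, hd₀⟩ := exists_gramCount_locally_constant ht hs
  refine ⟨d₀ + 2, fun n Q D hD => ?_⟩
  have hD0 : D ≠ 0 := by omega
  let π : ZMod (p ^ D) := p
  let t' := PadicInt.toZModPow D t
  let s' := PadicInt.toZModPow D s
  let S : ZMod (p ^ D) × ZMod (p ^ D) × ZMod (p ^ D) → Prop := fun b =>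
    b.1 = t' ∧ π ^ 2 * (b.2.1 - s') = 0 ∧ π ^ 1 * b.2.2 = 0
  have h1 := card_gram_mem (qForm D Q) (fun _ => True) S (repCount D Q t s)
    (fun a b c ⟨h1, h2, h3⟩ => hd₀ _ _ _ _ (fun _ _ _ _ => Iff.rfl) _ _ _ (by simp [show a = PadicInt.toZModPow D t from h1])
      ((pow_dvd_pow _ (by omega)).trans (pow_dvd_of_pow_mul_eq_zero (by omega) h2))
      ((pow_dvd_pow _ (by omega)).trans (pow_dvd_of_pow_mul_eq_zero (by omega) h3)))
  have h2 : Nat.card {b // S b} = p ^ 3 := by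
    have e : {b // S b} ≃ {b : ZMod (p ^ D) // π ^ 2 * b = 0} ×
        {b : ZMod (p ^ D) // π ^ 1 * b = 0} :=
      { toFun := fun b => (⟨_, b.2.2.1⟩, ⟨_, b.2.2.2⟩)
        invFun := fun b => ⟨(t', b.1 + s', b.2), rfl,
          (congrArg (π ^ 2 * ·) (add_sub_cancel_right _ _)).trans b.1.2, b.2.2⟩
        left_inv := by
          rintro ⟨⟨a, b, c⟩, h1, h2, h3⟩
          exact Subtype.ext (Prod.ext h1.symm (Prod.ext (sub_add_cancel _ _) rfl))
        right_inv := fun b => Prod.ext (Subtype.ext (add_sub_cancel_right _ _)) rfl }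
    rw [Nat.card_congr e, Nat.card_prod, card_pow_mul_eq_zero (by omega),
      card_pow_mul_eq_zero (by omega)]
    ring
  have h3 := card_preimage_of_fibers
    (fun z : (Fin n → ZMod (p ^ D)) × (Fin n → ZMod (p ^ D)) => (z.1, π • z.2))
    (fun z => (qForm D Q z.1 = t' ∧ qForm D Q z.2 = PadicInt.toZModPow D ((p : ℤ_[p]) ^ 2 * s) ∧
      polar (qForm D Q) z.1 z.2 = 0) ∧ ¬ IsPrimVec z.2) (p ^ n) (by
      rintro ⟨x, y⟩ ⟨-, hy⟩
      obtain ⟨y, rfl⟩ := (not_isPrimVec_iff hD0 _).1 hy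
      have e : {z : (Fin n → ZMod (p ^ D)) × (Fin n → ZMod (p ^ D)) //
          (z.1, π • z.2) = (x, π • y)} ≃ {z : Fin n → ZMod (p ^ D) // π • z = π • y} :=
        { toFun := fun z => ⟨_, (Prod.mk.inj z.2).2⟩
          invFun := fun z => ⟨(x, z), Prod.ext rfl z.2⟩
          left_inv := by
            rintro ⟨⟨a, b⟩, h⟩
            exact Subtype.ext (Prod.ext (Prod.mk.inj h).1.symm rfl)
          right_inv := fun _ => rfl }
      rw [Nat.card_congr e]
      refine (card_fiber_eq_card_ker
        (DistribSMul.toAddMonoidHom (Fin n → ZMod (p ^ D)) π) y).trans ?_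
      have e' : {z : Fin n → ZMod (p ^ D) // π • z = 0} ≃
          (Fin n → {b : ZMod (p ^ D) // π ^ 1 * b = 0}) :=
        { toFun := fun z i => ⟨z.1 i, by simpa using congrFun z.2 i⟩
          invFun := fun z => ⟨fun i => z i, funext fun i => by simpa using (z i).2⟩
          left_inv := fun _ => rfl
          right_inv := fun _ => rfl }
      refine (Nat.card_congr e').trans ?_
      rw [Nat.card_fun, card_pow_mul_eq_zero (by omega)]
      simp)
  have h4 : ∀ z : (Fin n → ZMod (p ^ D)) × (Fin n → ZMod (p ^ D)),
      ((qForm D Q z.1 = t' ∧ qForm D Q (π • z.2) = PadicInt.toZModPow D ((p : ℤ_[p]) ^ 2 * s) ∧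
        polar (qForm D Q) z.1 (π • z.2) = 0) ∧ ¬ IsPrimVec (π • z.2)) ↔
      (S (qForm D Q z.1, qForm D Q z.2, polar (qForm D Q) z.1 z.2) ∧ True) := fun z => by
    have : ¬ IsPrimVec (π • z.2) := (not_isPrimVec_iff hD0 _).2 ⟨_, rfl⟩
    simp only [S, this, not_false_eq_true, and_true, QuadraticMap.map_smul, polar_smul_right,
      smul_eq_mul, map_mul, map_pow, map_natCast, mul_sub, sub_eq_zero, pow_one, ← _root_.sq]
    rfl
  rw [Nat.card_congr (Equiv.subtypeEquivRight h4)] at h3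
  rw [h2] at h1
  exact h1.symm.trans (h3.trans (mul_comm _ _))

end Primitive

section Counts

variable {R X : Type*} [CommRing R] [AddCommGroup X] [Module R X]

/-- The condition that `(a, u), (b, v)` in `⟨-N⟩ ⊥ q` are orthogonal of norms `t` and `w`. -/
def ExtGram (q : QuadraticForm R X) (N t w a b : R) (u v : X) : Prop :=
  q u - N * a ^ 2 = t ∧ q v - N * b ^ 2 = w ∧ polar q u v - 2 * N * a * b = 0

theorem card_extGram_unit (q : QuadraticForm R X) (N t w a : R) (b : Rˣ) :
    Nat.card {z : X × X // ExtGram q N t w a b z.1 z.2} =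
      gramCount q (fun _ => True) (t + (a * (↑b⁻¹ : R)) ^ 2 * w) (N + (↑b⁻¹ : R) ^ 2 * w)
        (-(2 * a * (↑b⁻¹ : R) ^ 2 * w)) := by
  set i : R := (↑b⁻¹ : R) with hi
  have hbi : (b : R) * i = 1 := b.mul_inv
  let e : X × X ≃ X × X :=
    { toFun := fun z => (z.1 - (a * i) • z.2, i • z.2)
      invFun := fun z => (z.1 + a • z.2, (b : R) • z.2)
      left_inv := fun z => by simp [smul_smul, hbi]
      right_inv := fun z => by
        simp [smul_smul, mul_assoc, mul_comm i, hbi] }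
  refine Nat.card_congr (e.subtypeEquiv ?_)
  rintro ⟨u, v⟩
  have e1 : q (u - (a * i) • v) = q u + (a * i) ^ 2 * q v - a * i * polar q u v := by
    have := map_smul_add_smul q 1 (-(a * i)) u v
    rw [one_smul, neg_smul, ← sub_eq_add_neg] at this
    rw [this]
    ring
  have e2 : q (i • v) = i ^ 2 * q v := by rw [q.map_smul, smul_eq_mul, _root_.sq]
  have e3 : polar q (u - (a * i) • v) (i • v) = i * polar q u v - 2 * a * i ^ 2 * q v := by
    rw [polar_smul_right, sub_eq_add_neg, ← neg_smul, polar_add_left, polar_smul_left,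
      polar_self_eq]
    simp only [smul_eq_mul]
    ring
  simp only [e, Equiv.coe_fn_mk, ExtGram, e1, e2, e3, and_true]
  generalize q u = A
  generalize q v = B
  generalize polar q u v = C
  have hb2 : (b : R) ^ 2 * i ^ 2 = 1 := by rw [← mul_pow, hbi, one_pow]
  constructor
  · rintro ⟨h1, h2, h3⟩
    refine ⟨?_, ?_, ?_⟩
    · linear_combination h1 + (a * i) ^ 2 * h2 - a * i * h3 + a ^ 2 * N * hb2 -
        2 * a ^ 2 * N * hbi
    · linear_combination i ^ 2 * h2 + N * hb2
    · linear_combination i * h3 - 2 * a * i ^ 2 * h2 + 2 * N * a * hbi - 2 * a * N * hb2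
  · rintro ⟨h1, h2, h3⟩
    have h2' : B - N * b ^ 2 = w := by
      linear_combination (b : R) ^ 2 * h2 - (B - w) * hb2
    have h3' : C - 2 * N * a * b = 0 := by
      linear_combination (b : R) * h3 - C * hbi + 2 * a * b * i ^ 2 * h2' + 2 * a * N * b * hb2
    refine ⟨?_, h2', h3'⟩
    linear_combination h1 - (a * i) ^ 2 * h2' + a * i * h3' - a ^ 2 * N * hb2 +
      2 * a ^ 2 * N * hbi

/-- A choice, for every vector satisfying `P`, of an isotropic vector pairing to `1` with it,
invariant under shears along that vector with parameter divisible by `π`. -/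
structure IsDualChoice (q : QuadraticForm R X) (P : X → Prop) (π : R) (f : X → X) : Prop where
  isotropic : ∀ v, P v → q (f v) = 0
  polar_eq_one : ∀ v, P v → polar q v (f v) = 1
  pred_shear : ∀ v, P v → ∀ c, P (v + (π * c) • f v)
  map_shear : ∀ v, P v → ∀ c, f (v + (π * c) • f v) = f v

namespace IsDualChoice

variable {q : QuadraticForm R X} {P : X → Prop} {π : R} {f : X → X}

theorem map_add_smul (hf : IsDualChoice q P π f) {v : X} (hv : P v) (u : X) (c : R) :
    q (u + c • f v) = q u + c * polar q u (f v) := by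
  have := map_smul_add_smul q 1 c u (f v)
  rw [one_smul, hf.isotropic v hv] at this
  rw [this]
  ring

theorem polar_self (hf : IsDualChoice q P π f) {v : X} (hv : P v) :
    polar q (f v) (f v) = 0 := by
  rw [polar_self_eq, hf.isotropic v hv, mul_zero]

theorem polar_add_smul (hf : IsDualChoice q P π f) {v : X} (hv : P v) (u : X) (c : R) :
    polar q (u + c • f v) (f v) = polar q u (f v) := by
  rw [polar_add_left, polar_smul_left, hf.polar_self hv, smul_zero, add_zero]

theorem card_norm_eq (hf : IsDualChoice q P π f) {a b : R} (h : π ∣ b - a) :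
    Nat.card {v // q v = a ∧ P v} = Nat.card {v // q v = b ∧ P v} := by
  obtain ⟨c, hc⟩ := h
  refine Nat.card_congr
    { toFun := fun v => ⟨v.1 + (π * c) • f v.1, ?_, hf.pred_shear _ v.2.2 c⟩
      invFun := fun v => ⟨v.1 + (π * -c) • f v.1, ?_, hf.pred_shear _ v.2.2 _⟩
      left_inv := ?_
      right_inv := ?_ }
  · rw [hf.map_add_smul v.2.2, hf.polar_eq_one _ v.2.2, v.2.1]
    linear_combination -hc
  · rw [hf.map_add_smul v.2.2, hf.polar_eq_one _ v.2.2, v.2.1]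
    linear_combination hc
  · rintro ⟨v, -, hv⟩
    simp [hf.map_shear v hv]
  · rintro ⟨v, -, hv⟩
    simp only [hf.map_shear v hv]
    simp

theorem card_extGram (hf : IsDualChoice q P π f) {N : R} (hN : π ∣ N) (t w b : R) :
    Nat.card {z : R × X × X // ExtGram q N t w z.1 b z.2.1 z.2.2 ∧ P z.2.2} =
      Nat.card {z : R × X × X // (q z.2.1 = t + z.1 ^ 2 * w ∧ q z.2.2 = N + w ∧
        polar q z.2.1 z.2.2 = -(2 * z.1 * w)) ∧ P z.2.2} := by
  obtain ⟨N₀, hN₀⟩ := hN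
  let κ := π * (N₀ * (1 - b ^ 2))
  have hκ : κ = N * (1 - b ^ 2) := by rw [hN₀]; ring
  let F : R × X × X → X := fun z => f z.2.2
  let shift : R → R → R → R := fun a a' α => 2 * N * (a' - a * b) - α * κ
  let α : R × X × X → R := fun z => polar q z.2.1 (F z)
  let α' : R × X × X → R := fun z => polar q (z.2.1 + z.1 • z.2.2) (F z)
  have hpol : ∀ u v, P v → ∀ β, polar q (u + β • f v) (v + κ • f v) =
      polar q u v + κ * polar q u (f v) + β := fun u v hv β => by
    rw [polar_add_right, polar_smul_right, hf.polar_add_smul hv, polar_add_left, polar_smul_left,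
      polar_comm q (f v) v, hf.polar_eq_one v hv, smul_eq_mul, smul_eq_mul]
    ring
  have hsub : ∀ (u v : X) (a : R), q (u - a • v) = q u + a ^ 2 * q v - a * polar q u v ∧
      polar q (u - a • v) v = polar q u v - 2 * a * q v := fun u v a => by
    have := map_smul_add_smul q 1 (-a) u v
    rw [one_smul] at this
    rw [sub_eq_add_neg, ← neg_smul, this, polar_add_left, polar_smul_left, polar_self_eq]
    simp only [smul_eq_mul]
    constructor <;> ring
  let toF : R × X × X → R × X × X := fun z =>
    let a' := z.1 + (1 - b) * α z
    (a', z.2.1 + shift z.1 a' (α z) • F z - a' • (z.2.2 + κ • F z), z.2.2 + κ • F z)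
  let inF : R × X × X → R × X × X := fun z =>
    let a := z.1 - (1 - b) * α' z
    (a, z.2.1 + z.1 • z.2.2 - shift a z.1 (α' z) • F z, z.2.2 - κ • F z)
  have hneg : ∀ v, v - κ • f v = v + (π * -(N₀ * (1 - b ^ 2))) • f v := fun v => by
    rw [mul_neg, neg_smul, ← sub_eq_add_neg]
  have hP : ∀ v, P v → P (v - κ • f v) := fun v hv => hneg v ▸ hf.pred_shear v hv _
  have hfv : ∀ v, P v → f (v - κ • f v) = f v := fun v hv => by
    rw [hneg, hf.map_shear v hv]
  have hleft : ∀ z, P z.2.2 → inF (toF z) = z := by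
    rintro ⟨a, u, v⟩ hv
    have h1 : f (v + κ • f v) = f v := hf.map_shear v hv _
    simp only [inF, toF, α', α, F, h1, sub_add_cancel, hf.polar_add_smul hv, add_sub_cancel_right]
  have hright : ∀ z, P z.2.2 → toF (inF z) = z := by
    rintro ⟨a, u, v⟩ hv
    have h1 : ∀ β : R, polar q (u + a • v - β • f v) (f v) = polar q (u + a • v) (f v) :=
      fun β => by
        rw [sub_eq_add_neg, ← neg_smul, hf.polar_add_smul hv]
    simp only [inF, toF, α', α, F, hfv v hv, sub_add_cancel, h1, add_sub_cancel_right]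
  have hiff : ∀ z, P z.2.2 → (ExtGram q N t w z.1 b z.2.1 z.2.2 ↔
      (q (toF z).2.1 = t + (toF z).1 ^ 2 * w ∧ q (toF z).2.2 = N + w ∧
        polar q (toF z).2.1 (toF z).2.2 = -(2 * (toF z).1 * w))) := by
    rintro ⟨a, u, v⟩ hv
    simp only [toF, α, F, shift, ExtGram, hsub, hpol u v hv, hf.map_add_smul hv,
      hf.polar_eq_one v hv]
    simp only [hκ]
    generalize polar q u (f v) = A
    generalize polar q u v = C
    generalize q u = U
    generalize q v = V
    constructor
    · rintro ⟨h1, h2, h3⟩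
      refine ⟨?_, ?_, ?_⟩
      · linear_combination h1 + (a + (1 - b) * A) ^ 2 * h2 - (a + (1 - b) * A) * h3
      · linear_combination h2
      · linear_combination h3 - 2 * (a + (1 - b) * A) * h2
    · rintro ⟨h1, h2, h3⟩
      have h3' : C - 2 * N * a * b = 0 := by
        linear_combination h3 + 2 * (a + (1 - b) * A) * h2
      refine ⟨?_, ?_, h3'⟩
      · linear_combination h1 - (a + (1 - b) * A) ^ 2 * h2 + (a + (1 - b) * A) * h3'
      · linear_combination h2
  exact Nat.card_congr
    { toFun := fun z => ⟨toF z, (hiff z z.2.2).1 z.2.1, hf.pred_shear _ z.2.2 _⟩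
      invFun := fun z => ⟨inF z, (hiff (inF z) (hP _ z.2.2)).2 (by
        rw [hright z z.2.2]
        exact z.2.1), hP _ z.2.2⟩
      left_inv := fun z => Subtype.ext (hleft z z.2.2)
      right_inv := fun z => Subtype.ext (hright z z.2.2) }

end IsDualChoice

end Counts

section Hyperbolic

variable {p : ℕ} [Fact p.Prime] {K D : ℕ}

theorem Hplus_apply (x : Fin (2 * K) → ℤ_[p]) :
    Hplus p K x = ∑ i : Fin K, x ⟨2 * i.1, by have := i.2; omega⟩ *
      x ⟨2 * i.1 + 1, by have := i.2; omega⟩ := by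
  simp [Hplus, LinearMap.BilinMap.toQuadraticMap_apply]

theorem qForm_Hplus (x : Fin (2 * K) → ZMod (p ^ D)) :
    qForm D (Hplus p K) x = ∑ i : Fin K, x ⟨2 * i.1, by have := i.2; omega⟩ *
      x ⟨2 * i.1 + 1, by have := i.2; omega⟩ := by
  obtain ⟨z, rfl⟩ := exists_toZModPow_eq D x
  rw [qForm_apply, qRed_toZModPow, Hplus_apply]
  simp

theorem polar_qForm_Hplus (x y : Fin (2 * K) → ZMod (p ^ D)) :
    polar (qForm D (Hplus p K)) x y = ∑ i : Fin K,
      (x ⟨2 * i.1, by have := i.2; omega⟩ * y ⟨2 * i.1 + 1, by have := i.2; omega⟩ +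
        y ⟨2 * i.1, by have := i.2; omega⟩ * x ⟨2 * i.1 + 1, by have := i.2; omega⟩) := by
  simp only [polar, qForm_Hplus, ← Finset.sum_sub_distrib, Pi.add_apply]
  exact Finset.sum_congr rfl fun i _ => by ring

theorem exists_dual_single (j : Fin (2 * K)) : ∃ j' : Fin (2 * K), j' ≠ j ∧
    qForm D (Hplus p K) (Pi.single j' 1) = 0 ∧
    ∀ x, polar (qForm D (Hplus p K)) x (Pi.single j' 1) = x j := by
  have hq : ∀ j' : Fin (2 * K), qForm D (Hplus p K) (Pi.single j' 1) = 0 := fun j' => by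
    rw [qForm_Hplus]
    refine Finset.sum_eq_zero fun i _ => ?_
    by_cases h : j'.1 = 2 * i.1
    · refine mul_eq_zero_of_right _ (Pi.single_eq_of_ne (fun h' => ?_) 1)
      have := congrArg Fin.val h'
      simp only at this
      omega
    · exact mul_eq_zero_of_left (Pi.single_eq_of_ne (fun h' => h (congrArg Fin.val h').symm) 1) _
  have hj := j.2
  rcases Nat.even_or_odd' j.1 with ⟨i, hi | hi⟩
  · have hj' : j = ⟨2 * i, by omega⟩ := Fin.ext hi
    refine ⟨⟨2 * i + 1, by omega⟩, ?_, hq _, fun x => ?_⟩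
    · exact fun h => by simp [hj'] at h
    · rw [polar_qForm_Hplus, Finset.sum_eq_single ⟨i, by omega⟩]
      · simp [hj']
      · intro i' _ hi'
        have h1 : i'.1 ≠ i := fun h => hi' (Fin.ext h)
        have h2 : 2 * i'.1 ≠ 2 * i + 1 := by omega
        simp [h1, h2]
      · simp
  · have hj' : j = ⟨2 * i + 1, by omega⟩ := Fin.ext hi
    refine ⟨⟨2 * i, by omega⟩, ?_, hq _, fun x => ?_⟩
    · exact fun h => by simp [hj'] at h
    · rw [polar_qForm_Hplus, Finset.sum_eq_single ⟨i, by omega⟩]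
      · simp [hj']
      · intro i' _ hi'
        have h1 : i'.1 ≠ i := fun h => hi' (Fin.ext h)
        have h2 : 2 * i'.1 + 1 ≠ 2 * i := by omega
        simp [h1, h2]
      · simp

theorem exists_isDualChoice_Hplus (hD : D ≠ 0) (K : ℕ) :
    ∃ f, IsDualChoice (qForm D (Hplus p K)) IsPrimVec (p : ZMod (p ^ D)) f := by
  rcases Nat.eq_zero_or_pos K with rfl | hK
  · exact ⟨id, fun v ⟨j, _⟩ => j.elim0, fun v ⟨j, _⟩ => j.elim0, fun v ⟨j, _⟩ => j.elim0,
      fun v ⟨j, _⟩ => j.elim0⟩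
  have : Nonempty (Fin (2 * K)) := ⟨⟨0, by omega⟩⟩
  choose σ hne hq hpol using exists_dual_single (p := p) (K := K) (D := D)
  let idx : (Fin (2 * K) → ZMod (p ^ D)) → Fin (2 * K) := fun v =>
    Classical.epsilon fun j => IsUnit (v j)
  have hidx : ∀ v, IsPrimVec v → IsUnit (v (idx v)) := fun v hv => Classical.epsilon_spec hv
  let f : (Fin (2 * K) → ZMod (p ^ D)) → Fin (2 * K) → ZMod (p ^ D) := fun v =>
    Ring.inverse (v (idx v)) • Pi.single (σ (idx v)) 1
  refine ⟨f, fun v _ => ?_, fun v hv => ?_, fun v hv c => ?_, fun v _ c => ?_⟩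
  · rw [QuadraticMap.map_smul, hq, smul_zero]
  · rw [polar_smul_right, hpol, smul_eq_mul, Ring.inverse_mul_cancel _ (hidx v hv)]
  · have := isPrimVec_unit_smul_add_iff hD 1 c (f v) v
    rw [Units.val_one, one_smul] at this
    exact this.2 hv
  · have h1 : idx (v + (p * c) • f v) = idx v := by
      refine congrArg Classical.epsilon (funext fun j => propext ?_)
      rw [Pi.add_apply, Pi.smul_apply, smul_eq_mul, mul_assoc, isUnit_add_prime_mul_iff hD]
    have h2 : f v (idx v) = 0 := by
      simp only [f, Pi.smul_apply, Pi.single_eq_of_ne (hne _).symm, smul_zero]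
    change Ring.inverse ((v + (p * c) • f v) (idx (v + (p * c) • f v))) •
      Pi.single (σ (idx (v + (p * c) • f v))) 1 = f v
    rw [h1, Pi.add_apply, Pi.smul_apply, h2, smul_zero, add_zero]

end Hyperbolic

section PrimitiveDensity

variable {p : ℕ} [Fact p.Prime] {n : ℕ}

theorem isUnit_castHom_iff {d D : ℕ} (hd : d ≠ 0) (h : d ≤ D) (z : ZMod (p ^ D)) :
    IsUnit (ZMod.castHom (pow_dvd_pow p h) (ZMod (p ^ d)) z) ↔ IsUnit z := by
  refine ⟨fun hz => ?_, fun hz => hz.map _⟩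
  rw [isUnit_iff_not_dvd (by omega)]
  rintro ⟨w, rfl⟩
  rw [map_mul, map_natCast] at hz
  exact not_isUnit_prime hd (isUnit_of_mul_isUnit_left hz)

/-- The number of primitive vectors of norm `c` in the reduction of `Q` modulo `p ^ d`. -/
noncomputable def primCount (d : ℕ) (Q : QuadraticForm ℤ_[p] (Fin n → ℤ_[p])) (c : ZMod (p ^ d)) :
    ℕ :=
  Nat.card {v // qForm d Q v = c ∧ IsPrimVec v}

theorem mem_PRepSet_diagLat {d : ℕ} (hd : d ≠ 0) (Q : QuadraticForm ℤ_[p] (Fin n → ℤ_[p]))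
    (c : ℤ_[p]) (T : Matrix (Fin n) (Fin 1) (ZMod (p ^ d))) :
    T ∈ PRepSet p Q (diagLat p c) d ↔
      qForm d Q (T.col 0) = PadicInt.toZModPow d c ∧ IsPrimVec (T.col 0) := by
  have h1 : ∀ x : Fin 1 → ZMod (p ^ d), T.mulVec x = x 0 • T.col 0 := fun x => by
    ext i
    simp [Matrix.mulVec, dotProduct, mul_comm]
  have h2 : ∀ x : Fin 1 → ZMod (p ^ d),
      qRed p d (diagLat p c) x = PadicInt.toZModPow d c * x 0 ^ 2 := fun x => by
    obtain ⟨z, rfl⟩ := exists_toZModPow_eq d x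
    rw [qRed_toZModPow, diagLat_apply]
    simp
  refine and_congr ⟨fun h => ?_, fun h x => ?_⟩ ⟨?_, ?_⟩
  · have := h 1
    rw [h1, h2] at this
    simpa [qForm_apply] using this
  · rw [h1, h2, ← qForm_apply, QuadraticMap.map_smul, h, smul_eq_mul]
    ring
  · rintro ⟨S, hS⟩
    by_contra hT
    obtain ⟨v, hv⟩ := (not_isPrimVec_iff hd _).1 hT
    refine not_isUnit_prime (p := p) hd (isUnit_of_dvd_one ?_)
    have := congrFun (congrFun hS 0) 0
    rw [Matrix.one_apply_eq, Matrix.mul_apply] at this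
    rw [← this]
    refine Finset.dvd_sum fun j _ => Dvd.dvd.mul_left ⟨v j, congrFun hv j⟩ _
  · rintro ⟨j, u, hu⟩
    refine ⟨Matrix.of fun _ => Pi.single j (↑u⁻¹ : ZMod (p ^ d)), ?_⟩
    ext a b
    rw [Subsingleton.elim a 0, Subsingleton.elim b 0]
    have hu' : T j 0 = u := hu.symm
    simp [Matrix.mul_apply, Pi.single_apply, hu']

theorem ncard_PRepSet_diagLat {d : ℕ} (hd : d ≠ 0) (Q : QuadraticForm ℤ_[p] (Fin n → ℤ_[p]))
    (c : ℤ_[p]) :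
    (PRepSet p Q (diagLat p c) d).ncard = primCount d Q (PadicInt.toZModPow d c) := by
  rw [← Nat.card_coe_set_eq]
  let e : Matrix (Fin n) (Fin 1) (ZMod (p ^ d)) ≃ (Fin n → ZMod (p ^ d)) :=
    { toFun := fun T => T.col 0
      invFun := fun v => Matrix.of fun i _ => v i
      left_inv := fun T => by
        ext i j
        rw [Subsingleton.elim j 0]
        rfl
      right_inv := fun _ => rfl }
  exact Nat.card_congr (e.subtypeEquiv (mem_PRepSet_diagLat hd Q c))

theorem primCount_succ {d : ℕ} (hd : d ≠ 0) {Q : QuadraticForm ℤ_[p] (Fin n → ℤ_[p])}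
    {f : (Fin n → ZMod (p ^ (d + 1))) → Fin n → ZMod (p ^ (d + 1))}
    (hf : IsDualChoice (qForm (d + 1) Q) IsPrimVec (p : ZMod (p ^ (d + 1))) f) (c : ℤ_[p]) :
    p * primCount (d + 1) Q (PadicInt.toZModPow (d + 1) c) =
      p ^ n * primCount d Q (PadicInt.toZModPow d c) := by
  have hle : d ≤ d + 1 := d.le_succ
  have h1 := card_subtype_of_fibers (qForm (d + 1) Q)
    (fun b => ZMod.castHom (pow_dvd_pow p hle) (ZMod (p ^ d)) b = PadicInt.toZModPow d c) IsPrimVec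
    (primCount (d + 1) Q (PadicInt.toZModPow (d + 1) c)) (fun b hb => hf.card_norm_eq (by
      refine (dvd_pow_self _ hd).trans ((castHom_eq_zero_iff hle _).1 ?_)
      rw [map_sub, castHom_toZModPow hle, hb, sub_self]))
  have h2 := card_preimage_of_fibers (redVec (p := p) hle n)
    (fun v => qForm d Q v = PadicInt.toZModPow d c ∧ IsPrimVec v) (p ^ n) (fun v _ => by
      rw [card_redVec_fiber, Nat.add_sub_cancel_left, one_mul])
  rw [card_castHom_fiber hle, Nat.add_sub_cancel_left, pow_one] at h1
  rw [← h1, mul_comm (p ^ n)]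
  refine Eq.trans (Nat.card_congr (Equiv.subtypeEquivRight fun v => ?_)) h2
  rw [qForm_redVec hle]
  exact and_congr Iff.rfl (exists_congr fun j => (isUnit_castHom_iff hd hle (v j)).symm)

theorem exists_hasPden_Hplus {K : ℕ} (hK : K ≠ 0) :
    ∃ δ : ℝ, δ ≠ 0 ∧ ∀ c : ℤ_[p], (p : ℤ_[p]) ∣ c → HasPden p (Hplus p K) (diagLat p c) δ := by
  have hp : (p : ℝ) ≠ 0 := Nat.cast_ne_zero.2 (Fact.out : p.Prime).ne_zero
  refine ⟨primCount 1 (Hplus p K) 0 / (p : ℝ) ^ ((2 * K : ℤ) - 1), ?_, fun c hc => ?_⟩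
  · refine div_ne_zero (Nat.cast_ne_zero.2 ?_) (zpow_ne_zero _ hp)
    have : Fact (1 < p ^ 1) := ⟨by simpa using (Fact.out : p.Prime).one_lt⟩
    obtain ⟨j, -, hj, -⟩ := exists_dual_single (p := p) (D := 1) (⟨0, by omega⟩ : Fin (2 * K))
    have : Nonempty {v // qForm 1 (Hplus p K) v = 0 ∧ IsPrimVec v} :=
      ⟨⟨_, hj, j, by simp⟩⟩
    exact Nat.card_pos.ne'
  · refine tendsto_const_nhds.congr' (eventually_atTop.2 ⟨1, fun d hd => ?_⟩)
    have hexp : ((2 * K : ℕ) : ℤ) * (1 : ℕ) - (1 : ℕ) * ((1 : ℕ) + 1) / 2 = 2 * K - 1 := by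
      push_cast
      norm_num
    dsimp only
    rw [hexp, ncard_PRepSet_diagLat (by omega)]
    induction d, hd using Nat.le_induction with
    | base =>
      have : PadicInt.toZModPow 1 c = 0 := by
        obtain ⟨c, rfl⟩ := hc
        rw [map_mul, map_natCast]
        have h : ((p : ℕ) : ZMod (p ^ 1)) = 0 := by
          rw [ZMod.natCast_eq_zero_iff, pow_one]
        rw [h, zero_mul]
      rw [this]
      simp
    | succ d hd ih =>
      rw [ih]
      obtain ⟨f, hf⟩ := exists_isDualChoice_Hplus (p := p) (D := d + 1) (by omega) K
      have h : (p : ℝ) * primCount (d + 1) (Hplus p K) (PadicInt.toZModPow (d + 1) c) =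
          (p : ℝ) ^ (2 * K) * primCount d (Hplus p K) (PadicInt.toZModPow d c) := by
        exact_mod_cast primCount_succ (by omega) hf c
      have e : (p : ℝ) ^ (((d + 1 : ℕ) : ℤ) * (2 * K - 1)) * p =
          (p : ℝ) ^ ((d : ℤ) * (2 * K - 1)) * (p : ℝ) ^ (2 * K) := by
        rw [← zpow_natCast, ← zpow_add_one₀ hp, ← zpow_add₀ hp]
        congr 1
        push_cast
        ring
      rw [div_eq_div_iff (zpow_ne_zero _ hp) (zpow_ne_zero _ hp)]
      refine mul_left_cancel₀ hp ?_
      linear_combination (primCount d (Hplus p K) (PadicInt.toZModPow d c) : ℝ) * e -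
        (p : ℝ) ^ ((d : ℤ) * (2 * K - 1)) * h

end PrimitiveDensity

section Extension

theorem card_subtype_and_add_not {A : Type*} [Finite A] (S P : A → Prop) :
    Nat.card {a // S a ∧ P a} + Nat.card {a // S a ∧ ¬ P a} = Nat.card {a // S a} := by
  classical
  have := Fintype.ofFinite A
  simp only [Nat.card_eq_fintype_card, Fintype.card_subtype, ← Finset.filter_filter]
  exact Finset.card_filter_add_card_filter_not _

/-- Splitting off the first coordinate. -/
def splitFirst (R : Type*) (n : ℕ) : (Fin (1 + n) → R) ≃ R × (Fin n → R) where
  toFun x := (x (Fin.castAdd n 0), fun i => x (Fin.natAdd 1 i))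
  invFun z := Fin.append (fun _ => z.1) z.2
  left_inv x := by
    refine Eq.trans ?_ (Fin.append_castAdd_natAdd (f := x))
    exact congrArg (Fin.append · _) (funext fun i => by rw [Subsingleton.elim i 0])
  right_inv z := by simp

theorem isPrimVec_splitFirst {R : Type*} [CommRing R] {n : ℕ} (x : Fin (1 + n) → R) :
    IsPrimVec x ↔ IsUnit (splitFirst _ n x).1 ∨ IsPrimVec (splitFirst _ n x).2 := by
  constructor
  · rintro ⟨j, hj⟩
    induction j using Fin.addCases with
    | left i => exact .inl (by rwa [Subsingleton.elim i 0] at hj)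
    | right i => exact .inr ⟨i, hj⟩
  · rintro (h | ⟨i, hi⟩)
    · exact ⟨_, h⟩
    · exact ⟨_, hi⟩

variable {p : ℕ} [Fact p.Prime] {n D : ℕ}

theorem qForm_orthSum_diagLat (N : ℤ_[p]) (Q : QuadraticForm ℤ_[p] (Fin n → ℤ_[p]))
    (x : Fin (1 + n) → ZMod (p ^ D)) :
    qForm D (orthSum p (diagLat p (-N)) Q) x = qForm D Q (splitFirst _ n x).2 -
      PadicInt.toZModPow D N * (splitFirst _ n x).1 ^ 2 := by
  obtain ⟨z, rfl⟩ := exists_toZModPow_eq D x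
  have : (splitFirst _ n fun i => PadicInt.toZModPow D (z i)).2 =
      fun i => PadicInt.toZModPow D (z (Fin.natAdd 1 i)) := rfl
  rw [this, qForm_apply, qForm_apply, qRed_toZModPow, qRed_toZModPow, orthSum_apply,
    diagLat_apply]
  simp [splitFirst]
  ring

theorem polar_qForm_orthSum_diagLat (N : ℤ_[p]) (Q : QuadraticForm ℤ_[p] (Fin n → ℤ_[p]))
    (x y : Fin (1 + n) → ZMod (p ^ D)) :
    polar (qForm D (orthSum p (diagLat p (-N)) Q)) x y =
      polar (qForm D Q) (splitFirst _ n x).2 (splitFirst _ n y).2 -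
        2 * PadicInt.toZModPow D N * (splitFirst _ n x).1 * (splitFirst _ n y).1 := by
  have h1 : (splitFirst (ZMod (p ^ D)) n (x + y)).1 =
    (splitFirst _ n x).1 + (splitFirst _ n y).1 := rfl
  have h2 : (splitFirst (ZMod (p ^ D)) n (x + y)).2 =
    (splitFirst _ n x).2 + (splitFirst _ n y).2 := rfl
  simp only [polar, qForm_orthSum_diagLat, h1, h2]
  ring

theorem gramCount_orthSum_diagLat (N : ℤ_[p]) (Q : QuadraticForm ℤ_[p] (Fin n → ℤ_[p]))
    (t w : ZMod (p ^ D)) :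
    gramCount (qForm D (orthSum p (diagLat p (-N)) Q)) IsPrimVec t w 0 =
      Nat.card {z : (ZMod (p ^ D) × ZMod (p ^ D)) × (Fin n → ZMod (p ^ D)) × (Fin n → ZMod (p ^ D))
        // ExtGram (qForm D Q) (PadicInt.toZModPow D N) t w z.1.1 z.1.2 z.2.1 z.2.2 ∧
          (IsUnit z.1.2 ∨ IsPrimVec z.2.2)} := by
  refine Nat.card_congr ((((splitFirst _ n).prodCongr (splitFirst _ n)).trans
    (Equiv.prodProdProdComm _ _ _ _)).subtypeEquiv fun z => ?_)
  rw [qForm_orthSum_diagLat, qForm_orthSum_diagLat, polar_qForm_orthSum_diagLat,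
    isPrimVec_splitFirst]
  rfl

theorem card_not_isUnit (hD : D ≠ 0) :
    Nat.card {b : ZMod (p ^ D) // ¬ IsUnit b} = p ^ (D - 1) := by
  have h : 1 ≤ D := by omega
  rw [← card_castHom_fiber h 0]
  refine Nat.card_congr (Equiv.subtypeEquivRight fun b => ?_)
  rw [castHom_eq_zero_iff h, pow_one, isUnit_iff_not_dvd hD, not_not]

theorem card_isUnit_add (hD : D ≠ 0) :
    Nat.card {b : ZMod (p ^ D) // IsUnit b} + p ^ (D - 1) = p ^ D := by
  have := card_subtype_and_add_not (fun _ => True) fun b : ZMod (p ^ D) => IsUnit b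
  simp only [true_and, card_not_isUnit hD] at this
  rw [this, Nat.card_congr (Equiv.subtypeUnivEquiv fun _ => trivial), Nat.card_zmod]

theorem exists_gramCount_extension {t N : ℤ_[p]} (ht : t ≠ 0) (hN : N ≠ 0) (hpN : (p : ℤ_[p]) ∣ N) :
    ∃ d₀ : ℕ, ∀ D ≠ 0, ∀ (n : ℕ) (Q : QuadraticForm ℤ_[p] (Fin n → ℤ_[p]))
      (f : (Fin n → ZMod (p ^ D)) → Fin n → ZMod (p ^ D)),
      IsDualChoice (qForm D Q) IsPrimVec (p : ZMod (p ^ D)) f → ∀ w : ZMod (p ^ D),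
      (p : ZMod (p ^ D)) ^ d₀ ∣ w →
      gramCount (qForm D (orthSum p (diagLat p (-N)) Q)) IsPrimVec (PadicInt.toZModPow D t) w 0 =
        p ^ D * Nat.card {b : ZMod (p ^ D) // IsUnit b} * repCount D Q t N +
        p ^ (D - 1) * (p ^ D * gramCount (qForm D Q) IsPrimVec (PadicInt.toZModPow D t)
          (PadicInt.toZModPow D N) 0) := by
  obtain ⟨d₀, hd₀⟩ := exists_gramCount_locally_constant ht hN
  refine ⟨d₀, fun D hD n Q f hf w hw => ?_⟩
  set T := PadicInt.toZModPow D t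
  set N₁ := PadicInt.toZModPow D N
  have hN₁ : (p : ZMod (p ^ D)) ∣ N₁ := by simpa using map_dvd (PadicInt.toZModPow (p := p) D) hpN
  have hU := card_subtype_prod (fun ab : ZMod (p ^ D) × ZMod (p ^ D) => IsUnit ab.2)
    (fun ab (z : (Fin n → ZMod (p ^ D)) × (Fin n → ZMod (p ^ D))) =>
      ExtGram (qForm D Q) N₁ T w ab.1 ab.2 z.1 z.2) (repCount D Q t N) (by
    rintro ⟨a, _⟩ ⟨b, rfl⟩
    refine (card_extGram_unit _ _ _ _ _ _).trans
      (hd₀ D n (qForm D Q) _ (fun _ _ _ _ => Iff.rfl) _ _ _ ?_ ?_ ?_)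
    · rw [add_sub_cancel_left]
      exact hw.mul_left _
    · rw [add_sub_cancel_left]
      exact hw.mul_left _
    · exact (hw.mul_left _).neg_right)
  have hab : Nat.card {ab : ZMod (p ^ D) × ZMod (p ^ D) // IsUnit ab.2} =
      p ^ D * Nat.card {b : ZMod (p ^ D) // IsUnit b} := by
    have := card_subtype_prod (fun _ : ZMod (p ^ D) => True)
      (fun _ (b : ZMod (p ^ D)) => IsUnit b) _ fun _ _ => rfl
    simpa using this
  have hV := card_subtype_prod (fun b : ZMod (p ^ D) => ¬ IsUnit b)
    (fun b (z : ZMod (p ^ D) × (Fin n → ZMod (p ^ D)) × (Fin n → ZMod (p ^ D))) =>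
      ExtGram (qForm D Q) N₁ T w z.1 b z.2.1 z.2.2 ∧ IsPrimVec z.2.2)
    (p ^ D * gramCount (qForm D Q) IsPrimVec T N₁ 0) (by
    intro b _
    rw [hf.card_extGram hN₁]
    have := card_subtype_prod (fun _ : ZMod (p ^ D) => True)
      (fun a (z : (Fin n → ZMod (p ^ D)) × (Fin n → ZMod (p ^ D))) =>
        (qForm D Q z.1 = T + a ^ 2 * w ∧ qForm D Q z.2 = N₁ + w ∧
          polar (qForm D Q) z.1 z.2 = -(2 * a * w)) ∧ IsPrimVec z.2)
      (gramCount (qForm D Q) IsPrimVec T N₁ 0) (by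
      intro a _
      refine hd₀ D n (qForm D Q) _ (isPrimVec_unit_smul_add_iff hD) _ _ _ ?_ ?_ ?_
      · rw [add_sub_cancel_left]
        exact hw.mul_left _
      · rwa [add_sub_cancel_left]
      · exact (hw.mul_left _).neg_right)
    simpa using this)
  rw [gramCount_orthSum_diagLat, ← card_subtype_and_add_not _ fun z => IsUnit z.1.2]
  rw [hab] at hU
  rw [card_not_isUnit hD] at hV
  rw [← hU, ← hV]
  congr 1
  · refine Nat.card_congr (Equiv.subtypeEquivRight fun z => ?_)
    tauto
  · refine Nat.card_congr
      { toFun := fun z => ⟨(z.1.1.2, z.1.1.1, z.1.2), z.2.2, z.2.1.1, z.2.1.2.resolve_left z.2.2⟩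
        invFun := fun z => ⟨((z.1.2.1, z.1.1), z.1.2.2), ⟨z.2.2.1, .inr z.2.2.2⟩, z.2.1⟩
        left_inv := fun _ => rfl
        right_inv := fun _ => rfl }

theorem exists_repCount_recursion {t N N' : ℤ_[p]} (ht : t ≠ 0) (hN : N ≠ 0)
    (hNN' : (p : ℤ_[p]) ^ 2 * N' = N) (k : ℕ) :
    ∃ m₀ : ℕ, ∀ m ≥ m₀, ∀ᶠ D in atTop,
      p ^ (2 * k) * repCount D (orthSum p (diagLat p (-N)) (Hplus p (k + 1))) t
          ((p : ℤ_[p]) ^ (m + 2)) +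
        (p ^ D) ^ 2 * repCount D (Hplus p (k + 1)) t N' =
      repCount D (orthSum p (diagLat p (-N)) (Hplus p (k + 1))) t ((p : ℤ_[p]) ^ m) +
        p ^ (2 * k) * (p ^ D) ^ 2 * repCount D (Hplus p (k + 1)) t N := by
  have hp0 : (p : ℤ_[p]) ≠ 0 := Nat.cast_ne_zero.2 (Fact.out : p.Prime).ne_zero
  have hN' : N' ≠ 0 := by
    rintro rfl
    exact hN (by rw [← hNN', mul_zero])
  obtain ⟨d₁, hd₁⟩ := exists_gramCount_extension ht hN
    (hNN' ▸ Dvd.dvd.mul_right (dvd_pow_self _ two_ne_zero) _)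
  obtain ⟨d₂, hd₂⟩ := exists_repCount_scale (p := p) ht hN'
  refine ⟨d₁, fun m hm => ?_⟩
  obtain ⟨d₃, hd₃⟩ := exists_repCount_scale (p := p) ht (pow_ne_zero m hp0)
  refine eventually_atTop.2 ⟨max (max d₂ d₃) 1, fun D hD => ?_⟩
  obtain ⟨f, hf⟩ := exists_isDualChoice_Hplus (p := p) (D := D) (by omega) (k + 1)
  have h1 := hd₁ D (by omega) _ _ f hf (PadicInt.toZModPow D ((p : ℤ_[p]) ^ (m + 2)))
    (by simpa using pow_dvd_pow (p : ZMod (p ^ D)) (by omega : d₁ ≤ m + 2))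
  have h2 := hd₂ _ (Hplus p (k + 1)) D (by omega)
  have h3 := hd₃ _ (orthSum p (diagLat p (-N)) (Hplus p (k + 1))) D (by omega)
  rw [hNN'] at h2
  rw [← pow_add, add_comm 2 m] at h3
  have h4 : ∀ (n : ℕ) (Q : QuadraticForm ℤ_[p] (Fin n → ℤ_[p])) (s : ℤ_[p]),
      gramCount (qForm D Q) IsPrimVec (PadicInt.toZModPow D t) (PadicInt.toZModPow D s) 0 +
        gramCount (qForm D Q) (fun y => ¬ IsPrimVec y) (PadicInt.toZModPow D t)
          (PadicInt.toZModPow D s) 0 = repCount D Q t s := fun n Q s => by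
    rw [repCount, gramCount, gramCount, gramCount, card_subtype_and_add_not]
    simp only [and_true]
  have h5 := h4 _ (Hplus p (k + 1)) N
  have h6 := h4 _ (orthSum p (diagLat p (-N)) (Hplus p (k + 1))) ((p : ℤ_[p]) ^ (m + 2))
  have h7 := card_isUnit_add (p := p) (D := D) (by omega)
  have h8 : p ^ D = p * p ^ (D - 1) := by
    rw [← pow_succ', Nat.sub_add_cancel (by omega)]
  refine Nat.eq_of_mul_eq_mul_left (pow_pos (Fact.out : p.Prime).pos 3) ?_
  set M := orthSum p (diagLat p (-N)) (Hplus p (k + 1))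
  set H := Hplus p (k + 1)
  zify at h1 h2 h3 h5 h6 h7 h8 ⊢
  linear_combination
    -((p : ℤ) ^ 3 * p ^ (2 * k)) * h6 + (p : ℤ) ^ 3 * p ^ (2 * k) * h1 +
      ((p : ℤ) ^ D) ^ 2 * h2 - h3 +
      (p : ℤ) ^ 3 * p ^ (2 * k) * p ^ (D - 1) * p ^ D * h5 +
      (p : ℤ) ^ 3 * p ^ (2 * k) * p ^ D * repCount D H t N * h7 +
      (p : ℤ) ^ D * p ^ (2 * k) * p ^ 2 * gramCount (qForm D H) (fun y => ¬ IsPrimVec y)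
        (PadicInt.toZModPow D t) (PadicInt.toZModPow D N) 0 * h8

end Extension

section Limit

theorem tendsto_zero_of_two_step {e : ℕ → ℝ} {ρ : ℝ} (h0 : 0 ≤ ρ) (h1 : ρ < 1) {m₀ : ℕ}
    (h : ∀ m ≥ m₀, e (m + 2) = ρ * e m) : Tendsto e atTop (𝓝 0) := by
  rw [← tendsto_add_atTop_iff_nat m₀]
  have hb : ∀ j, |e (j + m₀)| ≤ ρ ^ (j / 2) * (|e m₀| + |e (m₀ + 1)|) := fun j => by
    induction j using Nat.twoStepInduction with
    | zero => simp
    | one => simp [add_comm 1 m₀]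
    | more j ih _ =>
      rw [show j + 2 + m₀ = j + m₀ + 2 by ring, h _ (by omega), abs_mul, abs_of_nonneg h0,
        Nat.add_div_right j two_pos, pow_succ']
      nlinarith
  refine squeeze_zero_norm hb ?_
  have := ((tendsto_pow_atTop_nhds_zero_of_lt_one h0 h1).comp
    (Nat.tendsto_div_const_atTop two_ne_zero)).mul_const (|e m₀| + |e (m₀ + 1)|)
  rwa [zero_mul] at this

theorem tendsto_of_two_step {x : ℕ → ℝ} {ρ c : ℝ} (h0 : 0 ≤ ρ) (h1 : ρ < 1) {m₀ : ℕ}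
    (h : ∀ m ≥ m₀, x (m + 2) = ρ * x m + c) : Tendsto x atTop (𝓝 (c / (1 - ρ))) := by
  have hne : 1 - ρ ≠ 0 := by linarith
  have := tendsto_zero_of_two_step (e := fun m => x m - c / (1 - ρ)) h0 h1 (m₀ := m₀)
    fun m hm => by
      rw [h m hm]
      field_simp
      ring
  simpa using this.add_const (c / (1 - ρ))

end Limit

/-- for `k ≥ 1`, `t ≠ 0`, and `N ≠ 0` with `v_p(N) ≥ 2` (witnessed by
`N' = N·p^{-2} ∈ ℤ_p`, i.e. `p²·N' = N`),
`lim_{m→∞} Den(⟨−N⟩ ⊥ H_{2k+2}^+, ⟨t⟩ ⊥ ⟨p^m⟩)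
  = [Pden(H_{2k+4}^+, ⟨p⟩)/Pden(H_{2k+4}^+, ⟨N⟩)]
    · [Den(H_{2k+2}^+, ⟨N⟩ ⊥ ⟨t⟩) − p^{−2k}·Den(H_{2k+2}^+, ⟨N·p^{−2}⟩ ⊥ ⟨t⟩)] / (1 − p^{−2k})`,
all occurring local densities being defined. -/
theorem statement5 (p : ℕ) [Fact p.Prime] (k : ℕ) (hk : 1 ≤ k)
    (t N N' : ℤ_[p]) (ht : t ≠ 0) (hN : N ≠ 0) (hNN' : (p : ℤ_[p]) ^ 2 * N' = N) :
    ∃ (DP₁ DP₂ D₁ D₂ : ℝ) (Dm : ℕ → ℝ),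
      HasPden p (Hplus p (k + 2)) (diagLat p (p : ℤ_[p])) DP₁ ∧
      HasPden p (Hplus p (k + 2)) (diagLat p N) DP₂ ∧
      HasDen p (Hplus p (k + 1)) (orthSum p (diagLat p N) (diagLat p t)) D₁ ∧
      HasDen p (Hplus p (k + 1)) (orthSum p (diagLat p N') (diagLat p t)) D₂ ∧
      (∀ m : ℕ, HasDen p (orthSum p (diagLat p (-N)) (Hplus p (k + 1)))
        (orthSum p (diagLat p t) (diagLat p ((p : ℤ_[p]) ^ m))) (Dm m)) ∧
      Tendsto Dm atTop (𝓝 ((DP₁ / DP₂) *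
        ((D₁ - (p : ℝ) ^ (-(2 * (k : ℤ))) * D₂) / (1 - (p : ℝ) ^ (-(2 * (k : ℤ))))))) := by
  have hp : (p : ℝ) ≠ 0 := Nat.cast_ne_zero.2 (Fact.out : p.Prime).ne_zero
  have hp0 : (p : ℤ_[p]) ≠ 0 := Nat.cast_ne_zero.2 (Fact.out : p.Prime).ne_zero
  have hN' : N' ≠ 0 := by
    rintro rfl
    exact hN (by rw [← hNN', mul_zero])
  obtain ⟨δ, hδ, hPden⟩ := exists_hasPden_Hplus (p := p) (K := k + 2) (by omega)
  obtain ⟨D₁, hD₁⟩ := eventually_repDensity_eq hN ht (Hplus p (k + 1))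
  obtain ⟨D₂, hD₂⟩ := eventually_repDensity_eq hN' ht (Hplus p (k + 1))
  choose Dm hDm using fun m : ℕ => eventually_repDensity_eq ht (pow_ne_zero m hp0)
    (orthSum p (diagLat p (-N)) (Hplus p (k + 1)))
  refine ⟨δ, δ, D₁, D₂, Dm, hPden _ dvd_rfl,
    hPden _ (hNN' ▸ Dvd.dvd.mul_right (dvd_pow_self _ two_ne_zero) _),
    hasDen_of_eventually_eq hD₁, hasDen_of_eventually_eq hD₂,
    fun m => hasDen_of_eventually_eq (hDm m), ?_⟩
  rw [div_self hδ, one_mul]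
  have hρ : (p : ℝ) ^ (-(2 * (k : ℤ))) < 1 :=
    zpow_lt_one_of_neg₀ (by exact_mod_cast (Fact.out : p.Prime).one_lt) (by omega)
  obtain ⟨m₀, hm₀⟩ := exists_repCount_recursion ht hN hNN' k
  refine tendsto_of_two_step (m₀ := m₀) (by positivity) hρ fun m hm => ?_
  obtain ⟨D, h1, h2, h3, h4, h5⟩ :=
    (hD₁.and (hD₂.and ((hDm m).and ((hDm (m + 2)).and (hm₀ m hm))))).exists
  rw [← h1, ← h2, ← h3, ← h4, repDensity_comm D _ N t, repDensity_comm D _ N' t]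
  have h6 : ∀ s, repDensity D (orthSum p (diagLat p (-N)) (Hplus p (k + 1))) t s =
      repCount D (orthSum p (diagLat p (-N)) (Hplus p (k + 1))) t s /
        ((p : ℝ) ^ ((D : ℤ) * (2 * (2 * (k + 1) : ℕ) - 3)) * ((p : ℝ) ^ D) ^ 2) := fun s => by
    rw [repDensity, ← zpow_natCast, ← zpow_natCast, ← zpow_mul, ← zpow_add₀ hp]
    congr 2
    push_cast
    ring
  have h7 : (p : ℝ) ^ (2 * k) * repCount D (orthSum p (diagLat p (-N)) (Hplus p (k + 1))) t
          ((p : ℤ_[p]) ^ (m + 2)) +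
        ((p : ℝ) ^ D) ^ 2 * repCount D (Hplus p (k + 1)) t N' =
      repCount D (orthSum p (diagLat p (-N)) (Hplus p (k + 1))) t ((p : ℤ_[p]) ^ m) +
        (p : ℝ) ^ (2 * k) * ((p : ℝ) ^ D) ^ 2 * repCount D (Hplus p (k + 1)) t N := by
    exact_mod_cast h5
  have h8 : (p : ℝ) ^ (-(2 * (k : ℤ))) = ((p : ℝ) ^ (2 * k))⁻¹ := by
    rw [zpow_neg, ← zpow_natCast]
    push_cast
    rfl
  rw [h6, h6, h8, repDensity, repDensity]
  have hA : (p : ℝ) ^ ((D : ℤ) * (2 * (2 * (k + 1) : ℕ) - 3)) ≠ 0 := zpow_ne_zero _ hp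
  have hB : (p : ℝ) ^ D ≠ 0 := pow_ne_zero _ hp
  have hC : (p : ℝ) ^ (2 * k) ≠ 0 := pow_ne_zero _ hp
  generalize (p : ℝ) ^ ((D : ℤ) * (2 * (2 * (k + 1) : ℕ) - 3)) = A at *
  generalize (p : ℝ) ^ D = B at *
  generalize (p : ℝ) ^ (2 * k) = C at *
  field_simp
  linear_combination h7

end PaperStmt
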